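/- arXiv:1111.1162 — 4 statements merged into one kernel-verified Lean document; each statement's English description precedes it below -/
import Mathlib

section
/- If x¹ and x² are both global minimizers of the Lasso objective F_{y,λ} at the same data y and parameter λ > 0, then A x¹ = A x²; i.e., the Lasso fit μ̂_λ(y) = A x̂ is the same for every Lasso solution x̂ at (y, λ). -/
/-- The Lasso objective `F_{y,λ}(x) = (1/2)‖y − Ax‖₂² + λ‖x‖₁`, where the design
matrix `A` has columns `a i`, so `A x = ∑ i, x i • a i`. -/
noncomputable def lassoObj {n p : ℕ} (a : Fin p → EuclideanSpace ℝ (Fin n))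
    (lam : ℝ) (y : EuclideanSpace ℝ (Fin n)) (x : Fin p → ℝ) : ℝ :=
  (1 / 2) * ‖y - ∑ i, x i • a i‖ ^ 2 + lam * ∑ i, |x i|

/-- A Lasso solution at `(y, λ)` is a global minimizer of the Lasso objective. -/
def IsLassoSol {n p : ℕ} (a : Fin p → EuclideanSpace ℝ (Fin n))
    (lam : ℝ) (y : EuclideanSpace ℝ (Fin n)) (x : Fin p → ℝ) : Prop :=
  ∀ x' : Fin p → ℝ, lassoObj a lam y x ≤ lassoObj a lam y x'


/-- If `x¹` and `x²` are both global minimizers of the Lasso objective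
at the same data `y` and parameter `λ > 0`, then `A x¹ = A x²`: the Lasso fit is the
same for every Lasso solution at `(y, λ)`. -/
theorem lasso_fit_unique {n p : ℕ} (a : Fin p → EuclideanSpace ℝ (Fin n))
    (lam : ℝ) (hlam : 0 < lam) (y : EuclideanSpace ℝ (Fin n)) (x1 x2 : Fin p → ℝ)
    (h1 : IsLassoSol a lam y x1) (h2 : IsLassoSol a lam y x2) :
    ∑ i, x1 i • a i = ∑ i, x2 i • a i := by
  have hm1 := h1 (fun i => (1 / 2) * (x1 i + x2 i))
  have hm2 := h2 (fun i => (1 / 2) * (x1 i + x2 i))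
  unfold lassoObj at hm1 hm2
  have hS : ∑ i, ((1 / 2) * (x1 i + x2 i)) • a i
      = (1 / 2 : ℝ) • (∑ i, x1 i • a i + ∑ i, x2 i • a i) := by
    rw [← Finset.sum_add_distrib, Finset.smul_sum]
    exact Finset.sum_congr rfl fun i _ => by rw [mul_smul, add_smul]
  have hL : ∑ i, |(1 / 2) * (x1 i + x2 i)| ≤ (1 / 2) * (∑ i, |x1 i| + ∑ i, |x2 i|) := by
    rw [← Finset.sum_add_distrib, Finset.mul_sum]
    refine Finset.sum_le_sum fun i _ => ?_
    rw [abs_mul, abs_of_pos (by norm_num : (0 : ℝ) < 1 / 2)]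
    have := abs_add_le (x1 i) (x2 i)
    linarith
  rw [hS] at hm1 hm2
  generalize ∑ i, x1 i • a i = u at *
  generalize ∑ i, x2 i • a i = v at *
  have hpar := parallelogram_law_with_norm ℝ (y - u) (y - v)
  have e1 : y - (1 / 2 : ℝ) • (u + v) = (1 / 2 : ℝ) • ((y - u) + (y - v)) := by module
  have e2 : y - u - (y - v) = v - u := by abel
  rw [e1, norm_smul, Real.norm_of_nonneg (by norm_num : (0 : ℝ) ≤ 1 / 2)] at hm1 hm2
  rw [e2] at hpar
  have hL' := mul_le_mul_of_nonneg_left hL hlam.le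
  have h0 : ‖v - u‖ ^ 2 ≤ 0 := by nlinarith
  have h0' : ‖v - u‖ = 0 := by
    have := sq_nonneg ‖v - u‖
    exact pow_eq_zero_iff (two_ne_zero) |>.1 (le_antisymm h0 this)
  exact (sub_eq_zero.1 (norm_eq_zero.1 h0')).symm
end

section
/- For every y ∈ ℝⁿ and every λ > 0, there exists a Lasso solution x* at (y, λ) such that the family of columns (a_i)_{i ∈ supp(x*)} of A is linearly independent (in particular, the set of Lasso solutions is nonempty). -/
/-- A Lasso solution exists. -/
lemma lasso_exists_sol {n p : ℕ} (a : Fin p → EuclideanSpace ℝ (Fin n))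
    (lam : ℝ) (hlam : 0 < lam) (y : EuclideanSpace ℝ (Fin n)) :
    ∃ x : Fin p → ℝ, IsLassoSol a lam y x := by
  have hc : Continuous (lassoObj a lam y) := by
    unfold lassoObj
    fun_prop
  refine hc.exists_forall_le ?_
  refine Filter.tendsto_atTop_mono (f := fun x : Fin p → ℝ => lam * ‖x‖) ?_
    ((tendsto_norm_cocompact_atTop).const_mul_atTop hlam)
  intro x
  have h1 : ‖x‖ ≤ ∑ i, |x i| := by
    rw [pi_norm_le_iff_of_nonneg (Finset.sum_nonneg fun i _ => abs_nonneg _)]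
    intro i
    rw [Real.norm_eq_abs]
    exact Finset.single_le_sum (f := fun i => |x i|) (fun i _ => abs_nonneg _)
      (Finset.mem_univ i)
  have h2 := mul_le_mul_of_nonneg_left h1 hlam.le
  have h3 : 0 ≤ ‖y - ∑ i, x i • a i‖ ^ 2 := by positivity
  unfold lassoObj
  linarith

/-- Along a null direction supported in `supp x`, one can kill a coordinate without
increasing the objective. -/
lemma lasso_reduce {n p : ℕ} (a : Fin p → EuclideanSpace ℝ (Fin n))
    (lam : ℝ) (hlam : 0 < lam) (y : EuclideanSpace ℝ (Fin n)) (x g : Fin p → ℝ)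
    (hsupp : ∀ i, x i = 0 → g i = 0) (hg : ∃ i, g i ≠ 0) (hnull : ∑ i, g i • a i = 0)
    (hs : 0 ≤ ∑ i, SignType.sign (x i) * g i) :
    ∃ x' : Fin p → ℝ, lassoObj a lam y x' ≤ lassoObj a lam y x ∧
      (∀ i, x i = 0 → x' i = 0) ∧ ∃ i, x i ≠ 0 ∧ x' i = 0 := by
  classical
  have hex : ∃ i, 0 < g i * x i := by
    by_contra! hcon
    obtain ⟨j, hj⟩ := hg
    have hneg : ∑ i, SignType.sign (x i) * g i < ∑ i : Fin p, (0 : ℝ) := by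
      apply Finset.sum_lt_sum
      · intro i _
        have := hcon i
        rcases lt_trichotomy (x i) 0 with h | h | h
        · simp [sign_neg h]; nlinarith
        · simp [h]
        · simp [sign_pos h]; nlinarith
      · refine ⟨j, Finset.mem_univ _, ?_⟩
        have := hcon j
        rcases lt_trichotomy (x j) 0 with h | h | h
        · simp [sign_neg h]
          rcases lt_or_gt_of_ne hj with h' | h' <;> nlinarith
        · exact absurd (hsupp j h) hj
        · simp [sign_pos h]
          rcases lt_or_gt_of_ne hj with h' | h' <;> nlinarith
    simp at hneg
    linarith
  obtain ⟨j, hj, hmin⟩ := Finset.exists_min_image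
    (Finset.univ.filter fun i => 0 < g i * x i) (fun i => x i / g i)
    (by obtain ⟨i, hi⟩ := hex; exact ⟨i, by simpa using hi⟩)
  simp only [Finset.mem_filter, Finset.mem_univ, true_and] at hj hmin
  have hgj : g j ≠ 0 := by intro h; simp [h] at hj
  have hxj : x j ≠ 0 := by intro h; simp [h] at hj
  set t := x j / g j with ht
  have htpos : 0 < t := by
    have : t = g j * x j / (g j) ^ 2 := by rw [ht]; field_simp
    rw [this]; positivity
  refine ⟨fun i => x i - t * g i, ?_, ?_, j, hxj, ?_⟩
  · have hsum : ∑ i, (x i - t * g i) • a i = ∑ i, x i • a i := by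
      simp only [sub_smul, Finset.sum_sub_distrib, mul_smul, ← Finset.smul_sum, hnull]
      simp
    have habs : ∀ i, |x i - t * g i| = |x i| - t * (SignType.sign (x i) * g i) := by
      intro i
      rcases lt_trichotomy (x i) 0 with h | h | h
      · have : x i - t * g i ≤ 0 := by
          rcases lt_or_ge (g i) 0 with h' | h'
          · have h2 := hmin i (mul_pos_of_neg_of_neg h' h)
            rw [le_div_iff_of_neg h'] at h2
            linarith
          · nlinarith
        rw [abs_of_nonpos this, abs_of_neg h]
        simp [sign_neg h]; ring
      · simp [h, hsupp i h]
      · have : 0 ≤ x i - t * g i := by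
          rcases lt_or_ge 0 (g i) with h' | h'
          · have h2 := hmin i (mul_pos h' h)
            rw [le_div_iff₀ h'] at h2
            linarith
          · nlinarith
        rw [abs_of_nonneg this, abs_of_pos h]
        simp [sign_pos h]
    have hl1 : ∑ i, |x i - t * g i| ≤ ∑ i, |x i| := by
      simp only [habs, Finset.sum_sub_distrib, ← Finset.mul_sum]
      nlinarith
    unfold lassoObj
    rw [hsum]
    have := mul_le_mul_of_nonneg_left hl1 hlam.le
    linarith
  · intro i h
    simp [h, hsupp i h]
  · simp only [ht]
    field_simp
    simp

/-- For every `y` and every `λ > 0`, there exists a Lasso solution `x*`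
at `(y, λ)` whose active columns `(a i)_{i ∈ supp x*}` are linearly independent. -/
theorem lasso_exists_full_rank_solution {n p : ℕ} (a : Fin p → EuclideanSpace ℝ (Fin n))
    (lam : ℝ) (hlam : 0 < lam) (y : EuclideanSpace ℝ (Fin n)) :
    ∃ x : Fin p → ℝ, IsLassoSol a lam y x ∧
      LinearIndependent ℝ (fun i : {i : Fin p // x i ≠ 0} => a (i : Fin p)) := by
  classical
  let N : (Fin p → ℝ) → ℕ := fun x => (Finset.univ.filter fun i => x i ≠ 0).card
  have hne : ∃ k, ∃ x : Fin p → ℝ, IsLassoSol a lam y x ∧ N x = k := by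
    obtain ⟨x, hx⟩ := lasso_exists_sol a lam hlam y
    exact ⟨_, x, hx, rfl⟩
  obtain ⟨x, hx, hN⟩ := Nat.find_spec hne
  refine ⟨x, hx, ?_⟩
  by_contra hdep
  rw [Fintype.not_linearIndependent_iff] at hdep
  obtain ⟨c, hc0, ⟨j, hj⟩, hcj⟩ := hdep
  -- extend by zero
  let g : Fin p → ℝ := fun i => if h : x i ≠ 0 then c ⟨i, h⟩ else 0
  have hgsupp : ∀ i, x i = 0 → g i = 0 := fun i h => by simp [g, h]
  have hgj : g j ≠ 0 := by simpa [g, hj] using hcj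
  have hnull : ∑ i, g i • a i = 0 := by
    rw [← hc0, ← Finset.sum_filter_of_ne (p := fun i => x i ≠ 0),
      Finset.sum_subtype (p := fun i => x i ≠ 0) _ (by simp)]
    · refine Finset.sum_congr rfl fun i _ => ?_
      simp [g, i.2]
    · intro i _ h hi
      simp [hgsupp i hi] at h
  have key : ∀ g : Fin p → ℝ, (∀ i, x i = 0 → g i = 0) → g j ≠ 0 → ∑ i, g i • a i = 0 →
      0 ≤ ∑ i, SignType.sign (x i) * g i → False := by
    intro g h1 h2 h3 h4
    obtain ⟨x', hle, hz, i, hi, hi'⟩ := lasso_reduce a lam hlam y x g h1 ⟨j, h2⟩ h3 h4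
    have hlt : N x' < N x := by
      apply Finset.card_lt_card
      rw [Finset.ssubset_iff_of_subset]
      · exact ⟨i, by simpa using hi, by simpa using hi'⟩
      · intro k hk
        simp only [Finset.mem_filter, Finset.mem_univ, true_and] at hk ⊢
        exact fun h => hk (hz k h)
    rw [hN] at hlt
    exact Nat.find_min hne hlt ⟨x', fun z => hle.trans (hx z), rfl⟩
  rcases le_total 0 (∑ i, (SignType.sign (x i) : ℝ) * g i) with h | h
  · exact key g hgsupp hgj hnull h
  · refine key (fun i => - g i) (fun i hi => by simp [hgsupp i hi]) (by simpa using hgj)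
      (by simp [hnull]) ?_
    simpa using h
end

section
/- (Corollary 1, unbiased estimation of the degrees of freedom) Fix λ > 0. Then the degrees of freedom of the Lasso fit, df = Σ_{i=1}^n Cov(f(y)_i, y_i)/σ², equals the expectation of the minimal support size of Lasso solutions; explicitly, Σ_{i=1}^n ∫ f(y)_i · (y_i − μ_i) dP(y) = σ² ∫ m(y) dP(y). -/
open MeasureTheory ProbabilityTheory

/-- The Lasso objective `F_{y,λ}(x) = (1/2)‖y − Ax‖₂² + λ‖x‖₁`, where the design matrix
`A` has columns `a i`, so `(A x) j = ∑ i, x i * a i j`. -/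
noncomputable def lassoObjPi {n p : ℕ} (a : Fin p → Fin n → ℝ) (lam : ℝ)
    (y : Fin n → ℝ) (x : Fin p → ℝ) : ℝ :=
  (1 / 2) * ∑ j, (y j - ∑ i, x i * a i j) ^ 2 + lam * ∑ i, |x i|

/-- A Lasso solution at `(y, λ)` is a global minimizer of the Lasso objective. -/
def IsLassoSolPi {n p : ℕ} (a : Fin p → Fin n → ℝ) (lam : ℝ)
    (y : Fin n → ℝ) (x : Fin p → ℝ) : Prop :=
  ∀ x' : Fin p → ℝ, lassoObjPi a lam y x ≤ lassoObjPi a lam y x'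


open Filter Topology
open scoped NNReal ENNReal

/-- The image `A x`. -/
noncomputable def lassoImg {n p : ℕ} (a : Fin p → Fin n → ℝ) (x : Fin p → ℝ) : Fin n → ℝ :=
  fun j => ∑ i, x i * a i j

lemma lasso_vi {n p : ℕ} {a : Fin p → Fin n → ℝ} {lam : ℝ} (hlam : 0 < lam)
    {z : Fin n → ℝ} {x : Fin p → ℝ} (hx : IsLassoSolPi a lam z x) (x' : Fin p → ℝ) :
    ∑ j, (z j - lassoImg a x j) * (lassoImg a x' j - lassoImg a x j)
      ≤ lam * (∑ i, |x' i| - ∑ i, |x i|) := by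
  have key : ∀ t : ℝ, 0 < t → t ≤ 1 →
      ∑ j, (z j - lassoImg a x j) * (lassoImg a x' j - lassoImg a x j)
        - lam * (∑ i, |x' i| - ∑ i, |x i|)
        ≤ t / 2 * ∑ j, (lassoImg a x' j - lassoImg a x j) ^ 2 := by
    intro t ht ht1
    have h := hx (fun i => (1 - t) * x i + t * x' i)
    unfold lassoObjPi at h
    have himg : ∀ j, ∑ i, ((1 - t) * x i + t * x' i) * a i j
        = lassoImg a x j + t * (lassoImg a x' j - lassoImg a x j) := by
      intro j
      have : ∑ i, ((1 - t) * x i + t * x' i) * a i j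
          = (1 - t) * lassoImg a x j + t * lassoImg a x' j := by
        simp only [lassoImg, Finset.mul_sum, ← Finset.sum_add_distrib]
        exact Finset.sum_congr rfl fun i _ => by ring
      rw [this]; ring
    have hq : ∑ j, (z j - ∑ i, ((1 - t) * x i + t * x' i) * a i j) ^ 2
        = ∑ j, (z j - lassoImg a x j) ^ 2
          - 2 * t * ∑ j, (z j - lassoImg a x j) * (lassoImg a x' j - lassoImg a x j)
          + t ^ 2 * ∑ j, (lassoImg a x' j - lassoImg a x j) ^ 2 := by
      simp only [himg, Finset.mul_sum, ← Finset.sum_add_distrib, ← Finset.sum_sub_distrib]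
      exact Finset.sum_congr rfl fun i _ => by ring
    have habs : ∑ i, |(1 - t) * x i + t * x' i|
        ≤ (1 - t) * ∑ i, |x i| + t * ∑ i, |x' i| := by
      simp only [Finset.mul_sum, ← Finset.sum_add_distrib]
      refine Finset.sum_le_sum fun i _ => (abs_add_le _ _).trans ?_
      rw [abs_mul, abs_mul, abs_of_pos ht, abs_of_nonneg (by linarith : (0:ℝ) ≤ 1 - t)]
    rw [hq] at h
    have h2 := mul_le_mul_of_nonneg_left habs hlam.le
    change 1 / 2 * ∑ j, (z j - lassoImg a x j) ^ 2 + _ ≤ _ at h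
    set B := ∑ j, (z j - lassoImg a x j) * (lassoImg a x' j - lassoImg a x j)
    set D := ∑ j, (lassoImg a x' j - lassoImg a x j) ^ 2
    have h3 : t * (B - lam * (∑ i, |x' i| - ∑ i, |x i|)) ≤ t * (t / 2 * D) := by
      nlinarith
    exact le_of_mul_le_mul_left h3 ht
  by_contra hcon
  push Not at hcon
  set B := ∑ j, (z j - lassoImg a x j) * (lassoImg a x' j - lassoImg a x j)
  set D := ∑ j, (lassoImg a x' j - lassoImg a x j) ^ 2
  have hD : 0 ≤ D := Finset.sum_nonneg fun _ _ => sq_nonneg _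
  set δ := B - lam * (∑ i, |x' i| - ∑ i, |x i|) with hδ
  have hδpos : 0 < δ := by linarith
  have hpos : 0 < min 1 (δ / (D + 1)) := lt_min one_pos (by positivity)
  have h := key _ hpos (min_le_left _ _)
  have h1 : min 1 (δ / (D + 1)) * (D + 1) ≤ δ := by
    have := min_le_right 1 (δ / (D + 1))
    rwa [le_div_iff₀ (by positivity)] at this
  nlinarith

lemma lasso_nonexp {n p : ℕ} {a : Fin p → Fin n → ℝ} {lam : ℝ} (hlam : 0 < lam)
    {z z' : Fin n → ℝ} {x x' : Fin p → ℝ} (hx : IsLassoSolPi a lam z x)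
    (hx' : IsLassoSolPi a lam z' x') :
    ∑ j, (lassoImg a x j - lassoImg a x' j) ^ 2 ≤ ∑ j, (z j - z' j) ^ 2 := by
  have h1 := lasso_vi hlam hx x'
  have h2 := lasso_vi hlam hx' x
  have h3 : ∑ j, (2 * ((z j - lassoImg a x j) * (lassoImg a x' j - lassoImg a x j))
      + 2 * ((z' j - lassoImg a x' j) * (lassoImg a x j - lassoImg a x' j))) ≤ 0 := by
    rw [Finset.sum_add_distrib, ← Finset.mul_sum, ← Finset.mul_sum]
    linarith
  have h4 : ∑ j, ((lassoImg a x j - lassoImg a x' j) ^ 2 - (z j - z' j) ^ 2) ≤ 0 := by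
    refine le_trans (Finset.sum_le_sum fun j _ => ?_) h3
    nlinarith [sq_nonneg ((z j - z' j) - (lassoImg a x j - lassoImg a x' j))]
  rw [Finset.sum_sub_distrib] at h4
  linarith

lemma lasso_lipschitz {n p : ℕ} {a : Fin p → Fin n → ℝ} {lam : ℝ} (hlam : 0 < lam)
    {f : (Fin n → ℝ) → Fin n → ℝ}
    (hf : ∀ z, ∃ x : Fin p → ℝ, IsLassoSolPi a lam z x ∧ f z = fun j => ∑ i, x i * a i j)
    (i : Fin n) : LipschitzWith (n : ℝ≥0) (fun z => f z i) := by
  refine LipschitzWith.of_dist_le_mul fun z z' => ?_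
  obtain ⟨x, hx, hfx⟩ := hf z
  obtain ⟨x', hx', hfx'⟩ := hf z'
  have h := lasso_nonexp hlam hx hx'
  have e1 : f z = lassoImg a x := hfx
  have e2 : f z' = lassoImg a x' := hfx'
  rw [e1, e2, Real.dist_eq]
  have hn : (1 : ℝ) ≤ n := by
    have : 1 ≤ n := by have := i.2; omega
    exact_mod_cast this
  refine abs_le_of_sq_le_sq ?_ (by positivity)
  calc (lassoImg a x i - lassoImg a x' i) ^ 2
      ≤ ∑ j, (lassoImg a x j - lassoImg a x' j) ^ 2 :=
        Finset.single_le_sum (f := fun j => (lassoImg a x j - lassoImg a x' j) ^ 2)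
          (fun _ _ => sq_nonneg _) (Finset.mem_univ i)
    _ ≤ ∑ j, (z j - z' j) ^ 2 := h
    _ ≤ ∑ j : Fin n, (dist z z') ^ 2 := by
        refine Finset.sum_le_sum fun j _ => ?_
        rw [← sq_abs (z j - z' j), ← Real.dist_eq]
        gcongr
        exact dist_le_pi_dist z z' j
    _ = n * (dist z z') ^ 2 := by simp
    _ ≤ (((n : ℝ≥0) : ℝ) * dist z z') ^ 2 := by
        rw [mul_pow]
        gcongr
        simp only [NNReal.coe_natCast]
        nlinarith

lemma lasso_kkt {n p : ℕ} {a : Fin p → Fin n → ℝ} {lam : ℝ} (hlam : 0 < lam)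
    {z : Fin n → ℝ} {x : Fin p → ℝ} (hx : IsLassoSolPi a lam z x) (i : Fin p) (hi : x i ≠ 0) :
    ∑ j, (z j - lassoImg a x j) * a i j = lam * SignType.sign (x i) := by
  have key : ∀ c : ℝ, |c + 1| = 1 + c →
      c * (x i * ∑ j, (z j - lassoImg a x j) * a i j) ≤ c * (lam * |x i|) := by
    intro c hc
    have h := lasso_vi hlam hx (Function.update x i ((c + 1) * x i))
    have h1 : ∀ j, lassoImg a (Function.update x i ((c + 1) * x i)) j - lassoImg a x j
        = c * x i * a i j := by
      intro j
      simp only [lassoImg, ← Finset.sum_sub_distrib]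
      rw [Finset.sum_eq_single i]
      · simp; ring
      · intro b _ hb; simp [Function.update_of_ne hb]
      · simp
    have h2 : ∑ k, |Function.update x i ((c + 1) * x i) k| - ∑ k, |x k| = c * |x i| := by
      rw [← Finset.sum_sub_distrib, Finset.sum_eq_single i]
      · simp [abs_mul, hc]; ring
      · intro b _ hb; simp [Function.update_of_ne hb]
      · simp
    simp only [h1] at h
    rw [h2] at h
    calc _ = ∑ j, (z j - lassoImg a x j) * (c * x i * a i j) := by
          simp only [Finset.mul_sum]
          exact Finset.sum_congr rfl fun j _ => by ring
      _ ≤ _ := h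
      _ = _ := by ring
  have h1 := key 1 (by norm_num)
  have h2 := key (-1) (by norm_num)
  have h3 : x i * ∑ j, (z j - lassoImg a x j) * a i j = lam * |x i| := by linarith
  apply mul_left_cancel₀ hi
  rw [h3]
  have := self_mul_sign (x i)
  rw [← this]; ring

/-- A solution of minimal support has linearly independent active columns. -/
lemma lasso_indep {n p : ℕ} {a : Fin p → Fin n → ℝ} {lam : ℝ} (hlam : 0 < lam)
    {z : Fin n → ℝ} {x : Fin p → ℝ} (hx : IsLassoSolPi a lam z x)
    (hmin : ∀ x', IsLassoSolPi a lam z x' → {i | x i ≠ 0}.ncard ≤ {i | x' i ≠ 0}.ncard)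
    (c : Fin p → ℝ) (hc : ∀ i, x i = 0 → c i = 0) (hac : ∀ j, ∑ i, c i * a i j = 0) :
    c = 0 := by
  by_contra hne
  have hex : (Finset.univ.filter fun i => c i ≠ 0).Nonempty := by
    obtain ⟨i, hi⟩ := Function.ne_iff.mp hne
    exact ⟨i, by simpa using hi⟩
  obtain ⟨k, hk, hkmin⟩ := Finset.exists_min_image _ (fun i => |x i / c i|) hex
  simp only [Finset.mem_filter, Finset.mem_univ, true_and] at hk hkmin
  set t := - (x k / c k) with ht
  have hbound : ∀ i, |t * c i| ≤ |x i| := by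
    intro i
    by_cases hi : c i = 0
    · simp [hi]
    · have := hkmin i hi
      rw [ht, abs_mul, abs_neg]
      calc _ ≤ |x i / c i| * |c i| := by gcongr
        _ = |x i| := by rw [← abs_mul, div_mul_cancel₀ _ hi]
  have hsign : ∑ i, c i * (SignType.sign (x i) : ℝ) = 0 := by
    have h0 : ∑ i, c i * (lam * (SignType.sign (x i) : ℝ)) = 0 := by
      calc _ = ∑ i, c i * ∑ j, (z j - lassoImg a x j) * a i j := by
            refine Finset.sum_congr rfl fun i _ => ?_
            by_cases hi : x i = 0
            · simp [hc i hi]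
            · rw [lasso_kkt hlam hx i hi]
        _ = ∑ j, (z j - lassoImg a x j) * ∑ i, c i * a i j := by
            simp only [Finset.mul_sum]
            rw [Finset.sum_comm]
            exact Finset.sum_congr rfl fun j _ => Finset.sum_congr rfl fun i _ => by ring
        _ = 0 := by simp [hac]
    have h1 : lam * ∑ i, c i * (SignType.sign (x i) : ℝ) = 0 := by
      rw [← h0, Finset.mul_sum]
      exact Finset.sum_congr rfl fun i _ => by ring
    exact (mul_eq_zero.mp h1).resolve_left hlam.ne'
  have habs : ∀ i, |x i + t * c i| = |x i| + t * (c i * (SignType.sign (x i) : ℝ)) := by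
    intro i
    have hb := abs_le.mp (hbound i)
    rcases lt_trichotomy (x i) 0 with h | h | h
    · rw [abs_of_neg h] at hb ⊢
      rw [abs_of_nonpos (by linarith), sign_neg h]
      simp; ring
    · simp [h, hc i h]
    · rw [abs_of_pos h] at hb ⊢
      rw [abs_of_nonneg (by linarith), sign_pos h]
      simp
  have hobj : lassoObjPi a lam z (fun i => x i + t * c i) = lassoObjPi a lam z x := by
    unfold lassoObjPi
    have e1 : ∀ j, ∑ i, (x i + t * c i) * a i j = ∑ i, x i * a i j := by
      intro j
      have : ∑ i, (x i + t * c i) * a i j = ∑ i, x i * a i j + t * ∑ i, c i * a i j := by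
        rw [Finset.mul_sum, ← Finset.sum_add_distrib]
        exact Finset.sum_congr rfl fun i _ => by ring
      rw [this, hac]; simp
    have e2 : ∑ i, |x i + t * c i| = ∑ i, |x i| := by
      simp only [habs]
      rw [Finset.sum_add_distrib, ← Finset.mul_sum, hsign]; simp
    simp only [e1, e2]
  have hsol : IsLassoSolPi a lam z (fun i => x i + t * c i) := by
    intro x'; rw [hobj]; exact hx x'
  have hlt : {i | x i + t * c i ≠ 0}.ncard < {i | x i ≠ 0}.ncard := by
    refine Set.ncard_lt_ncard ?_ (Set.toFinite _)
    refine ⟨fun i hi hxi => hi ?_, fun hsub => ?_⟩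
    · simp [hxi, hc i hxi]
    · have hxk : x k ≠ 0 := fun h => hk (hc k h)
      have := hsub (show k ∈ {i | x i ≠ 0} from hxk)
      apply this
      rw [ht]; field_simp; ring
  exact absurd (hmin _ hsol) (not_le.mpr hlt)

/-- Orthogonal projection on the span of independent columns. -/
lemma lasso_proj {n p : ℕ} (a : Fin p → Fin n → ℝ) (S : Finset (Fin p))
    (hS : LinearIndependent ℝ (fun i : S => a i)) :
    ∃ Q : (Fin n → ℝ) →ₗ[ℝ] (Fin n → ℝ),
      (∀ i ∈ S, Q (a i) = a i) ∧
      (∀ r, (∀ i ∈ S, ∑ j, r j * a i j = 0) → Q r = 0) ∧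
      ∑ j, Q (Pi.single j 1) j = S.card := by
  let e := WithLp.linearEquiv 2 ℝ (Fin n → ℝ)
  let V : Submodule ℝ (EuclideanSpace ℝ (Fin n)) :=
    Submodule.span ℝ (Set.range fun i : S => e.symm (a i))
  let T : EuclideanSpace ℝ (Fin n) →ₗ[ℝ] EuclideanSpace ℝ (Fin n) := V.starProjection.toLinearMap
  have hproj : LinearMap.IsProj V T :=
    ⟨fun x => V.starProjection_apply_mem x, fun x hx => Submodule.starProjection_eq_self_iff.mpr hx⟩
  refine ⟨e.toLinearMap ∘ₗ T ∘ₗ e.symm.toLinearMap, ?_, ?_, ?_⟩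
  · intro i hi
    have hm : e.symm (a i) ∈ V := Submodule.subset_span ⟨⟨i, hi⟩, rfl⟩
    simp [hproj.2 _ hm]
  · intro r hr
    have : T (e.symm r) = 0 := by
      refine (Submodule.starProjection_apply_eq_zero_iff V).mpr ?_
      rw [Submodule.mem_orthogonal]
      intro u hu
      induction hu using Submodule.span_induction with
      | mem u hu =>
        obtain ⟨i, rfl⟩ := hu
        have := hr i i.2
        simpa [e, PiLp.inner_apply, mul_comm] using this
      | zero => simp
      | add u v _ _ h1 h2 => rw [inner_add_left, h1, h2, add_zero]
      | smul c u _ h => rw [inner_smul_left, h, mul_zero]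
    simp [this]
  · have h1 := hproj.trace
    rw [LinearMap.trace_eq_sum_inner T (EuclideanSpace.basisFun (Fin n) ℝ)] at h1
    have h2 : Module.finrank ℝ V = S.card := by
      have : LinearIndependent ℝ (fun i : S => e.symm (a i)) :=
        hS.map' e.symm.toLinearMap e.symm.ker
      rw [finrank_span_eq_card this]; simp
    rw [h2] at h1
    rw [← h1]
    refine Finset.sum_congr rfl fun j _ => ?_
    rw [EuclideanSpace.basisFun_inner, EuclideanSpace.basisFun_apply]
    rfl


/-- Product Gaussian density. -/
noncomputable def gaussDens {n : ℕ} (μ : Fin n → ℝ) (v : ℝ≥0) (y : Fin n → ℝ) : ℝ :=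
  ∏ j, gaussianPDFReal (μ j) v (y j)

lemma gaussDens_nonneg {n : ℕ} (μ : Fin n → ℝ) (v : ℝ≥0) (y : Fin n → ℝ) :
    0 ≤ gaussDens μ v y := Finset.prod_nonneg fun _ _ => gaussianPDFReal_nonneg _ _ _

lemma gaussDens_contDiff {n : ℕ} (μ : Fin n → ℝ) (v : ℝ≥0) :
    ContDiff ℝ 1 (gaussDens μ v) := by
  unfold gaussDens gaussianPDFReal
  fun_prop

lemma gaussDens_hasLineDeriv {n : ℕ} (μ : Fin n → ℝ) {v : ℝ≥0} (hv : v ≠ 0) (i : Fin n)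
    (y : Fin n → ℝ) :
    HasLineDerivAt ℝ (gaussDens μ v) (-((y i - μ i) / v) * gaussDens μ v y) y
      (Pi.single i (1 : ℝ)) := by
  unfold HasLineDerivAt
  have e : (fun t : ℝ => gaussDens μ v (y + t • Pi.single i (1 : ℝ)))
      = fun t => gaussianPDFReal (μ i) v (y i + t) *
        ∏ j ∈ Finset.univ.erase i, gaussianPDFReal (μ j) v (y j) := by
    funext t
    unfold gaussDens
    rw [← Finset.mul_prod_erase _ _ (Finset.mem_univ i)]
    congr 1
    · simp
    · refine Finset.prod_congr rfl fun j hj => ?_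
      simp [Pi.single_eq_of_ne (Finset.ne_of_mem_erase hj)]
  have e2 : gaussDens μ v y = gaussianPDFReal (μ i) v (y i) *
        ∏ j ∈ Finset.univ.erase i, gaussianPDFReal (μ j) v (y j) :=
    (Finset.mul_prod_erase _ _ (Finset.mem_univ i)).symm
  rw [e, e2, ← mul_assoc]
  refine HasDerivAt.mul_const ?_ _
  have hv' : (v : ℝ) ≠ 0 := by exact_mod_cast hv
  have h1 : HasDerivAt (fun t : ℝ => -(y i + t - μ i) ^ 2 / (2 * (v : ℝ)))
      (-((y i - μ i) / v)) 0 := by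
    have := ((((hasDerivAt_id (0:ℝ)).const_add (y i)).sub_const (μ i)).pow 2).neg.div_const
      (2 * (v : ℝ))
    refine this.congr_deriv ?_
    simp only [id_eq, add_zero]
    field_simp
    norm_num
    ring
  have h2 := (h1.exp).const_mul ((√(2 * Real.pi * v))⁻¹)
  unfold gaussianPDFReal
  refine h2.congr_deriv ?_
  simp only [add_zero]
  ring

lemma gauss_pi_eq {n : ℕ} (μ : Fin n → ℝ) {v : ℝ≥0} (hv : v ≠ 0) :
    (Measure.pi fun j => gaussianReal (μ j) v)
      = (volume : Measure (Fin n → ℝ)).withDensity fun y => ENNReal.ofReal (gaussDens μ v y) := by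
  refine Measure.pi_eq fun s hs => ?_
  rw [withDensity_apply _ (MeasurableSet.univ_pi hs), volume_pi, Measure.restrict_pi_pi]
  have hInt : ∀ j, Integrable (gaussianPDFReal (μ j) v) (volume.restrict (s j)) :=
    fun j => (integrable_gaussianPDFReal _ _).restrict
  have hI : Integrable (gaussDens μ v) (Measure.pi fun j => volume.restrict (s j)) :=
    Integrable.fintype_prod_dep hInt
  rw [← ofReal_integral_eq_lintegral_ofReal hI (ae_of_all _ (gaussDens_nonneg μ v))]
  unfold gaussDens
  rw [integral_fintype_prod_eq_prod (fun j => gaussianPDFReal (μ j) v),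
    ENNReal.ofReal_prod_of_nonneg
      (fun j _ => integral_nonneg fun _ => gaussianPDFReal_nonneg _ _ _)]
  exact Finset.prod_congr rfl fun j _ => (gaussianReal_apply_eq_integral _ hv _).symm

lemma integral_gauss_pi {n : ℕ} (μ : Fin n → ℝ) {v : ℝ≥0} (hv : v ≠ 0) (g : (Fin n → ℝ) → ℝ) :
    ∫ y, g y ∂(Measure.pi fun j => gaussianReal (μ j) v) = ∫ y, g y * gaussDens μ v y := by
  rw [gauss_pi_eq μ hv, integral_withDensity_eq_integral_toReal_smul]
  · refine integral_congr_ae (ae_of_all _ fun y => ?_)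
    simp [ENNReal.toReal_ofReal (gaussDens_nonneg μ v y), mul_comm]
  · exact (gaussDens_contDiff μ v).continuous.measurable.ennreal_ofReal
  · exact ae_of_all _ fun y => ENNReal.ofReal_lt_top

lemma gauss_memLp_coord {n : ℕ} (μ : Fin n → ℝ) (v : ℝ≥0) (i : Fin n) :
    MemLp (fun y : Fin n → ℝ => y i) 2 (Measure.pi fun j => gaussianReal (μ j) v) :=
  (memLp_id_gaussianReal (μ := μ i) (v := v) 2).comp_measurePreserving
    (measurePreserving_eval (fun j => gaussianReal (μ j) v) i)

lemma gauss_memLp_lip {n : ℕ} (μ : Fin n → ℝ) (v : ℝ≥0) {f : (Fin n → ℝ) → ℝ} {C : ℝ≥0}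
    (hf : LipschitzWith C f) :
    MemLp f 2 (Measure.pi fun j => gaussianReal (μ j) v) := by
  have h1 : MemLp (fun y : Fin n → ℝ => |f 0| + C * ∑ j, |y j|) 2
      (Measure.pi fun j => gaussianReal (μ j) v) := by
    have h0 : MemLp (fun y : Fin n → ℝ => ∑ j, |y j|) 2
        (Measure.pi fun j => gaussianReal (μ j) v) :=
      memLp_finsetSum Finset.univ fun j _ => (gauss_memLp_coord μ v j).abs
    exact (memLp_const (|f 0|)).add (h0.const_mul (C : ℝ))
  refine h1.mono hf.continuous.aestronglyMeasurable (ae_of_all _ fun y => ?_)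
  have h2 : dist (f y) (f 0) ≤ C * dist y 0 := hf.dist_le_mul y 0
  have h3 : ‖y‖ ≤ ∑ j, |y j| := by
    refine (pi_norm_le_iff_of_nonneg (Finset.sum_nonneg fun _ _ => abs_nonneg _)).mpr fun j => ?_
    exact Finset.single_le_sum (f := fun j => |y j|) (fun _ _ => abs_nonneg _) (Finset.mem_univ j)
  have h4 : (C : ℝ) * dist y 0 ≤ C * ∑ j, |y j| := by rw [dist_zero_right]; gcongr
  rw [Real.dist_eq] at h2
  have h5 : |f y| ≤ |f y - f 0| + |f 0| := by
    have := abs_add_le (f y - f 0) (f 0); simpa using this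
  rw [Real.norm_eq_abs, Real.norm_eq_abs]
  exact le_trans (by linarith) (le_abs_self _)

/-- Stein identity for Lipschitz functions. -/
lemma gauss_stein {n : ℕ} (μ : Fin n → ℝ) {v : ℝ≥0} (hv : v ≠ 0) {f : (Fin n → ℝ) → ℝ} {C : ℝ≥0}
    (hf : LipschitzWith C f) (i : Fin n) :
    ∫ y, f y * (y i - μ i) ∂(Measure.pi fun j => gaussianReal (μ j) v)
      = v * ∫ y, lineDeriv ℝ f y (Pi.single i 1) ∂(Measure.pi fun j => gaussianReal (μ j) v) := by
  set P := Measure.pi fun j => gaussianReal (μ j) v with hP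
  let e : Fin n → ℝ := Pi.single i 1
  let b : ContDiffBump (0 : Fin n → ℝ) := ⟨1, 2, one_pos, one_lt_two⟩
  have hb : ContDiff ℝ 1 b := b.contDiff
  let R : ℕ → ℝ := fun k => ((k : ℝ) + 1)⁻¹
  have hR : ∀ k, 0 < R k := fun k => by positivity
  have hRlim : Tendsto R atTop (𝓝 0) := by
    simpa [R, one_div] using tendsto_one_div_add_atTop_nhds_zero_nat (𝕜 := ℝ)
  let χ : ℕ → (Fin n → ℝ) → ℝ := fun k y => b (R k • y)
  have hχs : ∀ k, HasCompactSupport (χ k) := fun k =>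
    b.hasCompactSupport.comp_smul (hR k).ne'
  have hχc : ∀ k, ContDiff ℝ 1 (χ k) := fun k => hb.comp (contDiff_const_smul (R k))
  obtain ⟨D, hD⟩ := hb.lipschitzWith_of_hasCompactSupport b.hasCompactSupport (by simp)
  have hbd : ∀ y, |lineDeriv ℝ b y e| ≤ D * ‖e‖ := fun y =>
    norm_lineDeriv_le_of_lipschitz ℝ hD
  have hχd : ∀ k y, HasLineDerivAt ℝ (χ k) (R k * lineDeriv ℝ b (R k • y) e) y e := by
    intro k y
    have h0 : HasLineDerivAt ℝ b (lineDeriv ℝ b (R k • y) e) (R k • y) e :=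
      ((hb.differentiable (by simp)).differentiableAt.lineDifferentiableAt).hasLineDerivAt
    have h1 := h0.smul (R k)
    unfold HasLineDerivAt at h1 ⊢
    simpa [χ, smul_add, smul_smul, mul_comm] using h1
  have hgl : ∀ k, ∃ L : ℝ≥0, LipschitzWith L (fun y => χ k y * gaussDens μ v y) := by
    intro k
    exact ((hχc k).mul (gaussDens_contDiff μ v)).lipschitzWith_of_hasCompactSupport
      ((hχs k).mul_right) (by simp)
  have hgd : ∀ k y, lineDeriv ℝ (fun y => χ k y * gaussDens μ v y) y (-e)
      = ((y i - μ i) / v * χ k y - R k * lineDeriv ℝ b (R k • y) e) * gaussDens μ v y := by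
    intro k y
    have h := HasDerivAt.mul (hχd k y) (gaussDens_hasLineDeriv μ hv i y)
    have h' : HasLineDerivAt ℝ (fun y => χ k y * gaussDens μ v y) _ y e := h
    rw [lineDeriv_neg, h'.lineDeriv]
    simp; ring
  have hibp : ∀ k, ∫ y, lineDeriv ℝ f y e * χ k y ∂P
      = ∫ y, f y * ((y i - μ i) / v * χ k y - R k * lineDeriv ℝ b (R k • y) e) ∂P := by
    intro k
    obtain ⟨L, hL⟩ := hgl k
    have h := hf.integral_lineDeriv_mul_eq (μ := volume) hL ((hχs k).mul_right) e
    rw [hP, integral_gauss_pi μ hv, integral_gauss_pi μ hv]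
    simp only [hgd] at h
    calc _ = _ := integral_congr_ae (ae_of_all _ fun y => by ring)
      _ = _ := h
      _ = _ := integral_congr_ae (ae_of_all _ fun y => by ring)
  have hχ1 : ∀ k y, |χ k y| ≤ 1 := fun k y => by
    rw [abs_of_nonneg b.nonneg]; exact b.le_one
  have hRy : ∀ y : Fin n → ℝ, Tendsto (fun k => R k • y) atTop (𝓝 0) := fun y => by
    simpa using hRlim.smul_const y
  have hχlim : ∀ y, Tendsto (fun k => χ k y) atTop (𝓝 1) := by
    intro y
    have : Tendsto (fun k => b (R k • y)) atTop (𝓝 (b 0)) :=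
      (hb.continuous.tendsto 0).comp (hRy y)
    rwa [b.one_of_mem_closedBall (by simp [b])] at this
  have hfm : Measurable fun y => lineDeriv ℝ f y e := measurable_lineDeriv hf.continuous
  have hbm : ∀ k, Measurable fun y : Fin n → ℝ => lineDeriv ℝ b (R k • y) e := fun k =>
    (measurable_lineDeriv hb.continuous).comp (measurable_const_smul (R k))
  have hf2 := gauss_memLp_lip μ v hf
  have hfi : Integrable f P := hf2.integrable (by norm_num)
  have hfy : Integrable (fun y => f y * (y i - μ i)) P :=
    hf2.integrable_mul ((gauss_memLp_coord μ v i).sub (memLp_const _))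
  have lim1 : Tendsto (fun k => ∫ y, lineDeriv ℝ f y e * χ k y ∂P) atTop
      (𝓝 (∫ y, lineDeriv ℝ f y e * 1 ∂P)) := by
    refine tendsto_integral_of_dominated_convergence (fun _ => C * ‖e‖) ?_ ?_ ?_ ?_
    · exact fun k => (hfm.mul (hχc k).continuous.measurable).aestronglyMeasurable
    · exact integrable_const _
    · refine fun k => ae_of_all _ fun y => ?_
      rw [norm_mul]
      have h1 : ‖lineDeriv ℝ f y e‖ ≤ C * ‖e‖ := norm_lineDeriv_le_of_lipschitz ℝ hf
      have h2 : ‖χ k y‖ ≤ 1 := hχ1 k y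
      calc _ ≤ (C * ‖e‖) * 1 := by gcongr
        _ = _ := mul_one _
    · exact ae_of_all _ fun y => (hχlim y).const_mul _
  have lim2 : Tendsto (fun k => ∫ y, f y *
      ((y i - μ i) / v * χ k y - R k * lineDeriv ℝ b (R k • y) e) ∂P) atTop
      (𝓝 (∫ y, f y * ((y i - μ i) / v * 1 - 0) ∂P)) := by
    refine tendsto_integral_of_dominated_convergence
      (fun y => |f y * (y i - μ i)| / v + |f y| * (D * ‖e‖)) ?_ ?_ ?_ ?_
    · intro k
      have := (hχc k).continuous.measurable
      have := hf.continuous.measurable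
      have := hbm k
      exact Measurable.aestronglyMeasurable (by fun_prop)
    · exact (hfy.abs.div_const _).add (hfi.abs.mul_const _)
    · refine fun k => ae_of_all _ fun y => ?_
      rw [Real.norm_eq_abs, mul_sub]
      refine (abs_sub _ _).trans ?_
      have hR1 : |R k| ≤ 1 := by
        rw [abs_of_pos (hR k)]
        exact inv_le_one_of_one_le₀ (by have : (0:ℝ) ≤ k := by positivity
                                        linarith)
      refine add_le_add ?_ ?_
      · have : f y * ((y i - μ i) / v * χ k y) = f y * (y i - μ i) / v * χ k y := by ring
        rw [this, abs_mul, abs_div, abs_of_nonneg v.coe_nonneg]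
        exact mul_le_of_le_one_right (by positivity) (hχ1 k y)
      · rw [abs_mul, abs_mul]
        refine mul_le_mul_of_nonneg_left ?_ (abs_nonneg _)
        calc _ ≤ 1 * (D * ‖e‖) := mul_le_mul hR1 (hbd _) (abs_nonneg _) zero_le_one
          _ = _ := one_mul _
    · refine ae_of_all _ fun y => ?_
      refine Tendsto.const_mul _ (((hχlim y).const_mul _).sub ?_)
      refine squeeze_zero_norm (a := fun k => R k * (D * ‖e‖)) (fun k => ?_) ?_
      · rw [norm_mul, Real.norm_of_nonneg (hR k).le]
        exact mul_le_mul_of_nonneg_left (hbd _) (hR k).le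
      · simpa using hRlim.mul_const (D * ‖e‖)
  simp only [hibp] at lim1
  have h := tendsto_nhds_unique lim1 lim2
  simp only [mul_one, sub_zero] at h
  change _ = (v : ℝ) * ∫ y, lineDeriv ℝ f y e ∂P
  rw [h, ← integral_const_mul]
  have hv' : (v : ℝ) ≠ 0 := by exact_mod_cast hv
  refine integral_congr_ae (ae_of_all _ fun y => ?_)
  simp only
  field_simp

/-- On the zero set of a Lipschitz function the line derivative vanishes almost everywhere. -/
lemma ae_lineDeriv_zero {n : ℕ} {h : (Fin n → ℝ) → ℝ} {C : ℝ≥0} (hh : LipschitzWith C h)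
    (v : Fin n → ℝ) : ∀ᵐ y, h y = 0 → lineDeriv ℝ h y v = 0 := by
  have habs : LipschitzWith (1 * C) (fun y => |h y|) := lipschitzWith_one_norm.comp hh
  filter_upwards [hh.ae_lineDifferentiableAt v, habs.ae_lineDifferentiableAt v] with y h1 h2 h0
  have d1 : HasDerivAt (fun t : ℝ => h (y + t • v)) (lineDeriv ℝ h y v) 0 := h1.hasLineDerivAt
  have d2 : HasDerivAt (fun t : ℝ => |h (y + t • v)|) (lineDeriv ℝ (fun y => |h y|) y v) 0 :=
    h2.hasLineDerivAt
  have hz : lineDeriv ℝ (fun y => |h y|) y v = 0 := by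
    refine IsLocalMin.hasDerivAt_eq_zero (Filter.Eventually.of_forall fun t => ?_) d2
    simp [h0]
  rw [hz] at d2
  have d3 : HasDerivAt (fun t : ℝ => h (y + t • v)) 0 0 := by
    rw [hasDerivAt_iff_isLittleO] at d2 ⊢
    simp only [smul_zero, sub_zero, zero_smul, add_zero, h0, abs_zero] at d2 ⊢
    exact (Asymptotics.isLittleO_norm_left).mp d2
  exact d1.unique d3

lemma lasso_fit_eq {n p : ℕ} {a : Fin p → Fin n → ℝ} {lam : ℝ} (hlam : 0 < lam)
    {f : (Fin n → ℝ) → Fin n → ℝ}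
    (hf : ∀ z, ∃ x : Fin p → ℝ, IsLassoSolPi a lam z x ∧ f z = fun j => ∑ i, x i * a i j)
    {z : Fin n → ℝ} {x : Fin p → ℝ} (hx : IsLassoSolPi a lam z x) : f z = lassoImg a x := by
  obtain ⟨x', hx', h⟩ := hf z
  have e : f z = lassoImg a x' := h
  rw [e]
  have h1 := lasso_nonexp hlam hx' hx
  simp only [sub_self, ne_eq, OfNat.ofNat_ne_zero, not_false_eq_true, zero_pow,
    Finset.sum_const_zero] at h1
  have h2 := (Finset.sum_eq_zero_iff_of_nonneg
    (fun j _ => sq_nonneg (lassoImg a x' j - lassoImg a x j))).mp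
    (le_antisymm h1 (Finset.sum_nonneg fun _ _ => sq_nonneg _))
  funext j
  have := h2 j (Finset.mem_univ j)
  exact sub_eq_zero.mp (pow_eq_zero_iff (two_ne_zero) |>.mp this)

lemma lasso_div_aux {n p : ℕ} {a : Fin p → Fin n → ℝ} {lam : ℝ} (hlam : 0 < lam)
    {f : (Fin n → ℝ) → Fin n → ℝ}
    (hf : ∀ z, ∃ x : Fin p → ℝ, IsLassoSolPi a lam z x ∧ f z = fun j => ∑ i, x i * a i j)
    (S : Finset (Fin p)) (s : Fin p → SignType) :
    ∀ᵐ z : Fin n → ℝ, ∀ x : Fin p → ℝ, IsLassoSolPi a lam z x → (∀ i, x i ≠ 0 ↔ i ∈ S) →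
      (∀ i, SignType.sign (x i) = s i) → LinearIndependent ℝ (fun i : S => a i) →
      ∑ j, lineDeriv ℝ (fun z => f z j) z (Pi.single j 1) = S.card := by
  by_cases hS : LinearIndependent ℝ (fun i : S => a i)
  swap
  · exact ae_of_all _ fun z x _ _ _ h => absurd h hS
  by_cases hex : ∃ z : Fin n → ℝ, ∃ x : Fin p → ℝ, IsLassoSolPi a lam z x ∧
      (∀ i, x i ≠ 0 ↔ i ∈ S) ∧ (∀ i, SignType.sign (x i) = s i)
  swap
  · exact ae_of_all _ fun z x h1 h2 h3 _ => absurd ⟨z, x, h1, h2, h3⟩ hex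
  obtain ⟨z0, x0, hx0, hS0, hs0⟩ := hex
  obtain ⟨Q, hQ1, hQ2, hQ3⟩ := lasso_proj a S hS
  set c := Q (z0 - f z0) with hc
  have haff : ∀ z x, IsLassoSolPi a lam z x → (∀ i, x i ≠ 0 ↔ i ∈ S) →
      (∀ i, SignType.sign (x i) = s i) → f z = Q z - c := by
    intro z x hx hxS hxs
    have h1 : Q (f z) = f z := by
      rw [lasso_fit_eq hlam hf hx]
      have : lassoImg a x = ∑ i, x i • a i := by
        funext j; simp [lassoImg]
      rw [this, map_sum]
      refine Finset.sum_congr rfl fun i _ => ?_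
      rw [map_smul]
      by_cases hi : x i = 0
      · simp [hi]
      · rw [hQ1 i ((hxS i).mp hi)]
    have h2 : Q ((z - f z) - (z0 - f z0)) = 0 := by
      refine hQ2 _ fun i hi => ?_
      have k1 := lasso_kkt hlam hx i ((hxS i).mpr hi)
      have k0 := lasso_kkt hlam hx0 i ((hS0 i).mpr hi)
      rw [hxs i] at k1
      rw [hs0 i] at k0
      rw [lasso_fit_eq hlam hf hx, lasso_fit_eq hlam hf hx0]
      simp only [Pi.sub_apply, sub_mul (_ - _ : ℝ), Finset.sum_sub_distrib]
      rw [k1, k0, sub_self]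
    rw [map_sub, sub_eq_zero, map_sub, h1, ← hc] at h2
    rw [← h2]; abel
  have hQl : ∀ j, ∃ K : ℝ≥0, LipschitzWith K (fun z => Q z j - c j) := by
    intro j
    let L : (Fin n → ℝ) →L[ℝ] ℝ := LinearMap.toContinuousLinearMap (LinearMap.proj j ∘ₗ Q)
    refine ⟨‖L‖₊, LipschitzWith.of_dist_le_mul fun z z' => ?_⟩
    have := L.lipschitz.dist_le_mul z z'
    simpa [L, Real.dist_eq] using this
  choose K hK using hQl
  have hQd : ∀ j z, HasLineDerivAt ℝ (fun z => Q z j - c j) (Q (Pi.single j 1) j) z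
      (Pi.single j (1 : ℝ)) := by
    intro j z
    unfold HasLineDerivAt
    have e : (fun t : ℝ => Q (z + t • Pi.single j (1 : ℝ)) j - c j)
        = fun t => Q z j + t * Q (Pi.single j 1) j - c j := by
      funext t; rw [map_add, map_smul]; rfl
    rw [e]
    have := (((hasDerivAt_id (0:ℝ)).mul_const (Q (Pi.single j 1) j)).const_add (Q z j)).sub_const
      (c j)
    refine this.congr_deriv ?_
    simp
  have h1 : ∀ᵐ z : Fin n → ℝ, ∀ j, f z j - (Q z j - c j) = 0 →
      lineDeriv ℝ (fun z => f z j - (Q z j - c j)) z (Pi.single j 1) = 0 :=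
    ae_all_iff.mpr fun j => ae_lineDeriv_zero ((lasso_lipschitz hlam hf j).sub (hK j)) _
  have h2 : ∀ᵐ z : Fin n → ℝ, ∀ j,
      LineDifferentiableAt ℝ (fun z => f z j) z (Pi.single j 1) :=
    ae_all_iff.mpr fun j => (lasso_lipschitz hlam hf j).ae_lineDifferentiableAt _
  filter_upwards [h1, h2] with z hz1 hz2 x hx hxS hxs _
  have hfz := haff z x hx hxS hxs
  rw [← hQ3]
  refine Finset.sum_congr rfl fun j _ => ?_
  have h3 := hz1 j (by rw [hfz]; simp)
  have h4 : HasLineDerivAt ℝ (fun z => f z j - (Q z j - c j)) _ z (Pi.single j (1 : ℝ)) :=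
    HasDerivAt.sub (hz2 j).hasLineDerivAt (hQd j z)
  rw [h4.lineDeriv] at h3
  linarith

lemma lasso_div {n p : ℕ} {a : Fin p → Fin n → ℝ} {lam : ℝ} (hlam : 0 < lam)
    {f : (Fin n → ℝ) → Fin n → ℝ}
    (hf : ∀ z, ∃ x : Fin p → ℝ, IsLassoSolPi a lam z x ∧ f z = fun j => ∑ i, x i * a i j)
    {m : (Fin n → ℝ) → ℕ} (hm : ∀ z, IsLeast
      {k : ℕ | ∃ x : Fin p → ℝ, IsLassoSolPi a lam z x ∧ {i | x i ≠ 0}.ncard = k} (m z)) :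
    ∀ᵐ z : Fin n → ℝ, ∑ j, lineDeriv ℝ (fun z => f z j) z (Pi.single j 1) = m z := by
  have h : ∀ᵐ z : Fin n → ℝ, ∀ (S : Finset (Fin p)) (s : Fin p → SignType), ∀ x : Fin p → ℝ,
      IsLassoSolPi a lam z x → (∀ i, x i ≠ 0 ↔ i ∈ S) →
      (∀ i, SignType.sign (x i) = s i) → LinearIndependent ℝ (fun i : S => a i) →
      ∑ j, lineDeriv ℝ (fun z => f z j) z (Pi.single j 1) = S.card :=
    ae_all_iff.mpr fun S => ae_all_iff.mpr fun s => lasso_div_aux hlam hf S s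
  filter_upwards [h] with z hz
  obtain ⟨⟨x, hx, hxm⟩, hlow⟩ := hm z
  let S : Finset (Fin p) := Finset.univ.filter fun i => x i ≠ 0
  have hcard : S.card = m z := by
    rw [← hxm, ← Set.ncard_coe_finset]
    congr 1
    ext i; simp [S]
  rw [← hcard]
  refine hz S (fun i => SignType.sign (x i)) x hx (fun i => by simp [S]) (fun i => rfl) ?_
  rw [Fintype.linearIndependent_iff]
  intro g hg i
  have hmin : ∀ x', IsLassoSolPi a lam z x' → {i | x i ≠ 0}.ncard ≤ {i | x' i ≠ 0}.ncard :=
    fun x' hx' => hxm ▸ hlow ⟨x', hx', rfl⟩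
  have hc := lasso_indep hlam hx hmin (fun i => if hi : i ∈ S then g ⟨i, hi⟩ else 0)
    (fun i hi => by simp [S, hi]) (fun j => by
      have h1 := congrFun hg j
      simp only [Finset.sum_apply, Pi.smul_apply, smul_eq_mul, Pi.zero_apply] at h1
      refine Eq.trans ?_ h1
      rw [← Finset.sum_subset (Finset.subset_univ S), ← Finset.sum_attach S]
      · exact Finset.sum_congr rfl fun i _ => by simp
      · intro i _ hi; simp [hi])
  have := congrFun hc i
  simpa using this

/-- Corollary 1, unbiased estimation of the degrees of freedom.
Fix `λ > 0`, let `μ = A x⁰` and let `P = N(μ, σ² Id)` be the Gaussian product measure on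
`ℝⁿ`. Let `f` select the Lasso fit (`f z = A x̂` for some Lasso solution `x̂` at `(z, λ)`)
and let `m z` be the minimal cardinality of the support of Lasso solutions at `(z, λ)`.
Then the degrees of freedom of the Lasso fit,
`df = ∑ i Cov(f(y)_i, y_i)/σ² = ∑ i ∫ f(y)_i (y_i − μ_i) dP / σ²`, equals `∫ m(y) dP`,
i.e. `∑ i ∫ f(y)_i (y_i − μ_i) dP = σ² ∫ m(y) dP`. -/
theorem lasso_dof_unbiased {n p : ℕ} (a : Fin p → Fin n → ℝ)
    (lam : ℝ) (hlam : 0 < lam) (x0 : Fin p → ℝ) (σ : ℝ) (hσ : 0 < σ)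
    (μ : Fin n → ℝ) (hμ : μ = fun j => ∑ i, x0 i * a i j)
    (P : Measure (Fin n → ℝ))
    (hP : P = Measure.pi fun j => gaussianReal (μ j) (Real.toNNReal (σ ^ 2)))
    (f : (Fin n → ℝ) → Fin n → ℝ) (hfmeas : Measurable f)
    (hf : ∀ z, ∃ x : Fin p → ℝ, IsLassoSolPi a lam z x ∧ f z = fun j => ∑ i, x i * a i j)
    (m : (Fin n → ℝ) → ℕ) (hmmeas : Measurable m)
    (hm : ∀ z, IsLeast
      {k : ℕ | ∃ x : Fin p → ℝ, IsLassoSolPi a lam z x ∧ {i | x i ≠ 0}.ncard = k} (m z)) :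
    ∑ i, ∫ y, f y i * (y i - μ i) ∂P = σ ^ 2 * ∫ y, (m y : ℝ) ∂P := by
  have hv : Real.toNNReal (σ ^ 2) ≠ 0 := by
    have : 0 < σ ^ 2 := by positivity
    exact (Real.toNNReal_pos.mpr this).ne'
  have hvc : ((Real.toNNReal (σ ^ 2) : ℝ≥0) : ℝ) = σ ^ 2 := Real.coe_toNNReal _ (sq_nonneg σ)
  have hac : P ≪ (volume : Measure (Fin n → ℝ)) := by
    rw [hP, gauss_pi_eq μ hv]; exact withDensity_absolutelyContinuous _ _
  have hprob : IsProbabilityMeasure P := by rw [hP]; infer_instance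
  have hst : ∀ i, ∫ y, f y i * (y i - μ i) ∂P
      = σ ^ 2 * ∫ y, lineDeriv ℝ (fun z => f z i) y (Pi.single i 1) ∂P := by
    intro i
    have h := gauss_stein μ hv (lasso_lipschitz hlam hf i) i
    rw [hvc, ← hP] at h
    exact h
  simp only [hst]
  rw [← Finset.mul_sum, ← integral_finsetSum]
  · congr 1
    exact integral_congr_ae (hac.ae_le (lasso_div hlam hf hm))
  · intro i _
    have hl := lasso_lipschitz hlam hf i
    refine Integrable.of_bound (measurable_lineDeriv hl.continuous).aestronglyMeasurable
      (((n : ℝ≥0) : ℝ) * ‖(Pi.single i (1 : ℝ) : Fin n → ℝ)‖) (ae_of_all _ fun y => ?_)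
    exact norm_lineDeriv_le_of_lipschitz ℝ hl
end

section
/- (Theorem 2, reliability identity) Fix λ > 0. Then ∫ ( SURE(y) − SE(y) )² dP(y) = −2σ⁴ n + 4σ² ∫ ‖f(y) − y‖₂² dP(y) + 4σ⁴ ∫ m(y) dP(y). -/
open MeasureTheory ProbabilityTheory

namespace LassoAux
open Filter Topology


lemma pi_gaussian_eq {n : ℕ} (μ : Fin n → ℝ) (v : NNReal) (hv : v ≠ 0) :
    (Measure.pi fun j => gaussianReal (μ j) v) =
      (volume : Measure (Fin n → ℝ)).withDensity
        (fun y => ENNReal.ofReal (∏ j, gaussianPDFReal (μ j) v (y j))) := by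
  refine Measure.pi_eq fun s hs => ?_
  have hint : Integrable (fun y : Fin n → ℝ => ∏ j, gaussianPDFReal (μ j) v (y j)) volume :=
    Integrable.fintype_prod (f := fun j => gaussianPDFReal (μ j) v)
      (fun j => integrable_gaussianPDFReal _ _)
  have hnn : ∀ y : Fin n → ℝ, 0 ≤ ∏ j, gaussianPDFReal (μ j) v (y j) :=
    fun y => Finset.prod_nonneg fun j _ => gaussianPDFReal_nonneg _ _ _
  rw [withDensity_apply _ (MeasurableSet.univ_pi hs),
    ← ofReal_integral_eq_lintegral_ofReal hint.integrableOn (ae_of_all _ hnn),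
    volume_pi, Measure.restrict_pi_pi,
    integral_fintype_prod_eq_prod (fun j => gaussianPDFReal (μ j) v),
    ENNReal.ofReal_prod_of_nonneg]
  · refine Finset.prod_congr rfl fun j _ => ?_
    rw [gaussianReal_apply_eq_integral _ hv]
  · intro j _
    exact integral_nonneg fun x => gaussianPDFReal_nonneg _ _ _

/-- the l1 norm -/
noncomputable def N {n : ℕ} (y : Fin n → ℝ) : ℝ := ∑ j, |y j|

lemma N_nonneg {n : ℕ} (y : Fin n → ℝ) : 0 ≤ N y := Finset.sum_nonneg fun _ _ => abs_nonneg _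

lemma integrable_expN {n : ℕ} (μ : Fin n → ℝ) (v : NNReal) (C : ℝ) :
    Integrable (fun y => Real.exp (C * N y)) (Measure.pi fun j => gaussianReal (μ j) v) := by
  have h : ∀ y : Fin n → ℝ, Real.exp (C * N y) = ∏ j, Real.exp (C * |y j|) := by
    intro y; rw [N, Finset.mul_sum, Real.exp_sum]
  simp_rw [h]
  refine Integrable.fintype_prod_dep (f := fun (j : Fin n) (t : ℝ) => Real.exp (C * |t|)) fun j => ?_
  refine Integrable.mono' ((integrable_exp_mul_gaussianReal (μ := μ j) (v := v) C).add
    (integrable_exp_mul_gaussianReal (μ := μ j) (v := v) (-C))) ?_ (ae_of_all _ fun t => ?_)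
  · exact (by fun_prop : Measurable fun t : ℝ => Real.exp (C * |t|)).aestronglyMeasurable
  · simp only [Pi.add_apply, Real.norm_eq_abs, Real.abs_exp]
    rcases abs_cases t with ⟨h, _⟩ | ⟨h, _⟩ <;> rw [h]
    · have := Real.exp_pos (-C * t); linarith
    · have := Real.exp_pos (C * t)
      have e : C * -t = -C * t := by ring
      rw [e]; linarith

/-- The shift in coordinate i by s -/
noncomputable def sh {n : ℕ} (i : Fin n) (s : ℝ) (y : Fin n → ℝ) : Fin n → ℝ := y + Pi.single i s

/-- The weight -/
noncomputable def W {n : ℕ} (μ : Fin n → ℝ) (σ : ℝ) (i : Fin n) (s : ℝ) (y : Fin n → ℝ) : ℝ :=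
  (Real.exp (((y i - μ i) * s) / σ ^ 2 - s ^ 2 / (2 * σ ^ 2)) - 1) / s

lemma integral_shift {n : ℕ} (μ : Fin n → ℝ) (σ : ℝ) (hσ : 0 < σ) (i : Fin n) (s : ℝ)
    (u : (Fin n → ℝ) → ℝ) :
    ∫ y, u (sh i s y) ∂(Measure.pi fun j => gaussianReal (μ j) (Real.toNNReal (σ ^ 2))) =
    ∫ y, u y * Real.exp (((y i - μ i) * s) / σ ^ 2 - s ^ 2 / (2 * σ ^ 2))
      ∂(Measure.pi fun j => gaussianReal (μ j) (Real.toNNReal (σ ^ 2))) := by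
  have hv : Real.toNNReal (σ ^ 2) ≠ 0 := by
    simp; positivity
  have hvc : ((Real.toNNReal (σ ^ 2) : NNReal) : ℝ) = σ ^ 2 := Real.coe_toNNReal _ (by positivity)
  generalize Real.toNNReal (σ ^ 2) = v at *
  have hnn : ∀ y : Fin n → ℝ, 0 ≤ ∏ j, gaussianPDFReal (μ j) v (y j) :=
    fun y => Finset.prod_nonneg fun j _ => gaussianPDFReal_nonneg _ _ _
  have hme : Measurable fun y : Fin n → ℝ =>
      ENNReal.ofReal (∏ j, gaussianPDFReal (μ j) v (y j)) := by
    refine ENNReal.measurable_ofReal.comp ?_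
    refine Finset.measurable_prod _ fun j _ => ?_
    exact (measurable_gaussianPDFReal _ _).comp (measurable_pi_apply j)
  have hlt : ∀ᵐ y : Fin n → ℝ, ENNReal.ofReal (∏ j, gaussianPDFReal (μ j) v (y j)) < ⊤ :=
    ae_of_all _ fun y => ENNReal.ofReal_lt_top
  rw [pi_gaussian_eq μ v hv, integral_withDensity_eq_integral_toReal_smul hme hlt,
    integral_withDensity_eq_integral_toReal_smul hme hlt]
  simp only [ENNReal.toReal_ofReal (hnn _), smul_eq_mul]
  rw [← integral_add_right_eq_self (μ := volume) (fun y : Fin n → ℝ =>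
    (∏ j, gaussianPDFReal (μ j) v (y j)) *
      (u y * Real.exp (((y i - μ i) * s) / σ ^ 2 - s ^ 2 / (2 * σ ^ 2)))) (Pi.single i s)]
  refine integral_congr_ae (ae_of_all _ fun y => ?_)
  simp only [sh]
  have e1 : (y + Pi.single i s : Fin n → ℝ) i = y i + s := by simp
  have e2 : ∀ j, j ≠ i → (y + Pi.single i s : Fin n → ℝ) j = y j := fun j hj => by simp [hj]
  generalize (y + Pi.single i s : Fin n → ℝ) = y' at *
  have key : ∏ j, gaussianPDFReal (μ j) v (y j) =
      (∏ j, gaussianPDFReal (μ j) v (y' j)) *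
      Real.exp (((y' i - μ i) * s) / σ ^ 2 - s ^ 2 / (2 * σ ^ 2)) := by
    rw [← Finset.mul_prod_erase _ _ (Finset.mem_univ i),
      ← Finset.mul_prod_erase _ (fun j => gaussianPDFReal (μ j) v (y' j))
        (Finset.mem_univ i)]
    have h1 : ∏ j ∈ Finset.univ.erase i, gaussianPDFReal (μ j) v (y' j)
        = ∏ j ∈ Finset.univ.erase i, gaussianPDFReal (μ j) v (y j) :=
      Finset.prod_congr rfl fun j hj => by rw [e2 j (Finset.ne_of_mem_erase hj)]
    have h2 : gaussianPDFReal (μ i) v (y i) = gaussianPDFReal (μ i) v (y' i) *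
        Real.exp (((y' i - μ i) * s) / σ ^ 2 - s ^ 2 / (2 * σ ^ 2)) := by
      simp only [gaussianPDFReal, hvc, e1]
      rw [mul_assoc, mul_assoc, ← Real.exp_add]
      congr 2
      field_simp
      ring
    rw [h1, h2]
    ring
  rw [key]
  ring

/-- Uniform exponential bound. -/
def UB {n : ℕ} (u : ℕ → (Fin n → ℝ) → ℝ) : Prop :=
  ∃ C : ℝ, 0 ≤ C ∧ ∀ k y, |u k y| ≤ C * Real.exp (C * N y)

lemma UB.of {n : ℕ} {u : ℕ → (Fin n → ℝ) → ℝ} (A B : ℝ)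
    (h : ∀ k y, |u k y| ≤ A * Real.exp (B * N y)) : UB u := by
  refine ⟨max |A| |B|, le_max_of_le_left (abs_nonneg _), fun k y => (h k y).trans ?_⟩
  have h1 : A ≤ max |A| |B| := (le_abs_self A).trans (le_max_left _ _)
  have h2 : B ≤ max |A| |B| := (le_abs_self B).trans (le_max_right _ _)
  have := N_nonneg y
  gcongr

lemma UB.add {n : ℕ} {u v : ℕ → (Fin n → ℝ) → ℝ} (hu : UB u) (hv : UB v) :
    UB (fun k y => u k y + v k y) := by
  obtain ⟨C, hC, h⟩ := hu
  obtain ⟨D, hD, h'⟩ := hv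
  refine UB.of (C + D) (C + D) fun k y => ?_
  have := N_nonneg y
  have e1 : Real.exp (C * N y) ≤ Real.exp ((C + D) * N y) := by gcongr; linarith
  have e2 : Real.exp (D * N y) ≤ Real.exp ((C + D) * N y) := by gcongr; linarith
  calc |u k y + v k y| ≤ |u k y| + |v k y| := abs_add_le _ _
    _ ≤ C * Real.exp (C * N y) + D * Real.exp (D * N y) := add_le_add (h k y) (h' k y)
    _ ≤ C * Real.exp ((C + D) * N y) + D * Real.exp ((C + D) * N y) := by gcongr
    _ = _ := by ring

lemma UB.mul {n : ℕ} {u v : ℕ → (Fin n → ℝ) → ℝ} (hu : UB u) (hv : UB v) :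
    UB (fun k y => u k y * v k y) := by
  obtain ⟨C, hC, h⟩ := hu
  obtain ⟨D, hD, h'⟩ := hv
  refine UB.of (C * D) (C + D) fun k y => ?_
  calc |u k y * v k y| = |u k y| * |v k y| := abs_mul _ _
    _ ≤ (C * Real.exp (C * N y)) * (D * Real.exp (D * N y)) := by
      gcongr
      · exact h k y
      · exact h' k y
    _ = _ := by rw [add_mul, Real.exp_add]; ring

lemma N_sh {n : ℕ} (i : Fin n) (s : ℝ) (y : Fin n → ℝ) : N (sh i s y) ≤ N y + |s| := by
  unfold N sh
  calc ∑ j, |(y + Pi.single i s : Fin n → ℝ) j|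
      ≤ ∑ j, (|y j| + |(Pi.single i s : Fin n → ℝ) j|) :=
        Finset.sum_le_sum fun j _ => abs_add_le _ _
    _ = _ := by
      rw [Finset.sum_add_distrib]
      congr 1
      rw [Finset.sum_eq_single i]
      · simp
      · intro j _ hj; simp [hj]
      · simp

/-- step sizes -/
noncomputable def st (k : ℕ) : ℝ := 1 / ((k : ℝ) + 1)

lemma st_pos (k : ℕ) : 0 < st k := by unfold st; positivity
lemma st_le (k : ℕ) : st k ≤ 1 := by
  unfold st; rw [div_le_one (by positivity)]; linarith [(Nat.cast_nonneg k : (0:ℝ) ≤ k)]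
lemma st_tendsto : Tendsto st atTop (𝓝 0) := tendsto_one_div_add_atTop_nhds_zero_nat

lemma UB.shift {n : ℕ} {u : ℕ → (Fin n → ℝ) → ℝ} (hu : UB u) (i : Fin n) (t : ℕ → ℝ)
    (ht : ∀ k, |t k| ≤ 1) :
    UB (fun k y => u k (sh i (t k) y)) := by
  obtain ⟨C, hC, h⟩ := hu
  refine UB.of (C * Real.exp C) C fun k y => (h k _).trans ?_
  rw [mul_assoc, ← Real.exp_add]
  have := N_sh i (t k) y
  have := ht k
  gcongr
  nlinarith

lemma measurable_sh {n : ℕ} (i : Fin n) (s : ℝ) : Measurable (sh i s) := by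
  unfold sh; fun_prop

lemma sh_comm {n : ℕ} (i j : Fin n) (s t : ℝ) (y : Fin n → ℝ) :
    sh i s (sh j t y) = sh j t (sh i s y) := by
  unfold sh; abel

/-- the Gaussian measure -/
noncomputable def G {n : ℕ} (μ : Fin n → ℝ) (σ : ℝ) : Measure (Fin n → ℝ) :=
  Measure.pi fun j => gaussianReal (μ j) (Real.toNNReal (σ ^ 2))

structure Good {n : ℕ} (P : Measure (Fin n → ℝ)) (u : ℕ → (Fin n → ℝ) → ℝ)
    (v : (Fin n → ℝ) → ℝ) : Prop where
  meas : ∀ k, Measurable (u k)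
  bdd : UB u
  lim : ∀ᵐ y ∂P, Tendsto (fun k => u k y) atTop (𝓝 (v y))

namespace Good
variable {n : ℕ} {P : Measure (Fin n → ℝ)} {u u' : ℕ → (Fin n → ℝ) → ℝ}
    {v v' : (Fin n → ℝ) → ℝ}

lemma add (h : Good P u v) (h' : Good P u' v') :
    Good P (fun k y => u k y + u' k y) (fun y => v y + v' y) :=
  ⟨fun k => (h.meas k).add (h'.meas k), h.bdd.add h'.bdd, by
    filter_upwards [h.lim, h'.lim] with y a b using a.add b⟩

lemma mul (h : Good P u v) (h' : Good P u' v') :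
    Good P (fun k y => u k y * u' k y) (fun y => v y * v' y) :=
  ⟨fun k => (h.meas k).mul (h'.meas k), h.bdd.mul h'.bdd, by
    filter_upwards [h.lim, h'.lim] with y a b using a.mul b⟩

lemma const (c : ℝ) : Good P (fun _ _ => c) (fun _ => c) :=
  ⟨fun k => measurable_const, UB.of |c| 0 (by intro k y; simp), ae_of_all _ fun y => tendsto_const_nhds⟩

lemma step : Good P (fun k _ => st k) (fun _ => 0) :=
  ⟨fun k => measurable_const, UB.of 1 0 (by
    intro k y; simp [abs_of_pos (st_pos k), st_le k]), ae_of_all _ fun y => st_tendsto⟩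

lemma sub (h : Good P u v) (h' : Good P u' v') :
    Good P (fun k y => u k y - u' k y) (fun y => v y - v' y) := by
  convert h.add ((const (-1)).mul h') using 3 <;> ring

lemma sum {ι : Type*} (s : Finset ι) {u : ι → ℕ → (Fin n → ℝ) → ℝ} {v : ι → (Fin n → ℝ) → ℝ}
    (h : ∀ i, Good P (u i) (v i)) :
    Good P (fun k y => ∑ i ∈ s, u i k y) (fun y => ∑ i ∈ s, v i y) := by
  classical
  induction s using Finset.induction_on with
  | empty => simpa using const 0
  | insert a s ha ih => simpa [Finset.sum_insert ha] using (h a).add ih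

lemma congr_ae (h : Good P u v) (e : v =ᵐ[P] v') : Good P u v' :=
  ⟨h.meas, h.bdd, by filter_upwards [h.lim, e] with y a b; rwa [← b]⟩

lemma fixed (h : Good P u v) (k : ℕ) : Good P (fun _ => u k) (u k) :=
  ⟨fun _ => h.meas k, let ⟨C, hC, H⟩ := h.bdd; ⟨C, hC, fun _ y => H k y⟩,
    ae_of_all _ fun y => tendsto_const_nhds⟩

lemma shiftFixed {w : (Fin n → ℝ) → ℝ} (h : Good P (fun _ => w) w) (i : Fin n) (s : ℝ)
    (hs : |s| ≤ 1) :
    Good P (fun _ y => w (sh i s y)) (fun y => w (sh i s y)) :=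
  ⟨fun _ => (h.meas 0).comp (measurable_sh i s), h.bdd.shift i (fun _ => s) (fun _ => hs),
    ae_of_all _ fun y => tendsto_const_nhds⟩

variable {μ : Fin n → ℝ} {σ : ℝ}

lemma integrable_seq (h : Good (G μ σ) u v) (k : ℕ) : Integrable (u k) (G μ σ) := by
  obtain ⟨C, hC, H⟩ := h.bdd
  exact ((integrable_expN μ (Real.toNNReal (σ ^ 2)) C).const_mul C).mono'
    (h.meas k).aestronglyMeasurable (ae_of_all _ fun y => H k y)

lemma tendsto_integral (h : Good (G μ σ) u v) :
    Tendsto (fun k => ∫ y, u k y ∂(G μ σ)) atTop (𝓝 (∫ y, v y ∂(G μ σ))) := by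
  obtain ⟨C, hC, H⟩ := h.bdd
  exact tendsto_integral_of_dominated_convergence (fun y => C * Real.exp (C * N y))
    (fun k => (h.meas k).aestronglyMeasurable)
    ((integrable_expN μ (Real.toNNReal (σ ^ 2)) C).const_mul C)
    (fun k => ae_of_all _ fun y => H k y) h.lim

lemma integrable (h : Good (G μ σ) u v) : Integrable v (G μ σ) := by
  obtain ⟨C, hC, H⟩ := h.bdd
  refine ((integrable_expN μ (Real.toNNReal (σ ^ 2)) C).const_mul C).mono'
    (aestronglyMeasurable_of_tendsto_ae atTop (fun k => (h.meas k).aestronglyMeasurable) h.lim) ?_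
  change ∀ᵐ y ∂(G μ σ), _
  filter_upwards [h.lim] with y hy
  exact le_of_tendsto hy.abs (Eventually.of_forall fun k => H k y)

end Good

lemma abs_coord_le {n : ℕ} (y : Fin n → ℝ) (i : Fin n) : |y i| ≤ N y :=
  Finset.single_le_sum (f := fun j => |y j|) (fun _ _ => abs_nonneg _) (Finset.mem_univ i)

lemma abs_exp_sub_one_le' (x : ℝ) : |Real.exp x - 1| ≤ |x| * Real.exp |x| := by
  rcases le_total 0 x with hx | hx
  · rw [abs_of_nonneg hx, abs_of_nonneg (by linarith [Real.add_one_le_exp x])]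
    have := Real.add_one_le_exp (-x)
    have h2 : Real.exp (-x) * Real.exp x = 1 := by rw [← Real.exp_add]; simp
    nlinarith [Real.exp_pos x]
  · have h1 : Real.exp x ≤ 1 := Real.exp_le_one_iff.2 hx
    rw [abs_of_nonpos hx, abs_of_nonpos (by linarith)]
    have := Real.add_one_le_exp x
    have h3 : 1 ≤ Real.exp (-x) := Real.one_le_exp (by linarith)
    nlinarith

lemma W_good {n : ℕ} {P : Measure (Fin n → ℝ)} (μ : Fin n → ℝ) (σ : ℝ) (hσ : 0 < σ) (i : Fin n) :
    Good P (fun k => W μ σ i (st k)) (fun y => (y i - μ i) / σ ^ 2) := by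
  refine ⟨fun k => ?_, ?_, ae_of_all _ fun y => ?_⟩
  · unfold W; fun_prop
  · set K : ℝ := (|μ i| + 1) / σ ^ 2 with hK
    have hK0 : 0 ≤ K := by positivity
    set B : ℝ := K + 1 / σ ^ 2 with hB
    refine UB.of (Real.exp (2 * K)) (2 * B) fun k y => ?_
    have hs := st_pos k
    have hs1 := st_le k
    have hN := N_nonneg y
    set x := ((y i - μ i) * st k) / σ ^ 2 - st k ^ 2 / (2 * σ ^ 2) with hx
    have hxle : |x| ≤ st k * (K + B * N y) := by
      have e : x = st k * ((y i - μ i - st k / 2) / σ ^ 2) := by rw [hx]; field_simp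
      rw [e, abs_mul, abs_of_pos hs, abs_div, abs_of_pos (show 0 < σ ^ 2 by positivity)]
      gcongr
      have h1 : |y i - μ i - st k / 2| ≤ N y + |μ i| + 1 := by
        have := abs_coord_le y i
        rw [abs_le] at *
        have := abs_le.1 (le_refl |μ i|)
        constructor <;> linarith
      calc _ ≤ (N y + |μ i| + 1) / σ ^ 2 := by gcongr
        _ = K + 1 / σ ^ 2 * N y := by rw [hK]; field_simp; ring
        _ ≤ K + B * N y := by gcongr; linarith
    have hB0 : 0 ≤ B := by positivity
    have hM : 0 ≤ K + B * N y := by positivity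
    have hxle' : |x| ≤ K + B * N y := hxle.trans (by nlinarith)
    unfold W
    rw [abs_div, abs_of_pos hs, div_le_iff₀ hs]
    calc |Real.exp x - 1| ≤ |x| * Real.exp |x| := abs_exp_sub_one_le' x
      _ ≤ (st k * (K + B * N y)) * Real.exp (K + B * N y) := by gcongr
      _ ≤ (st k * Real.exp (K + B * N y)) * Real.exp (K + B * N y) := by
        gcongr; linarith [Real.add_one_le_exp (K + B * N y)]
      _ = _ := by
        rw [mul_assoc, ← Real.exp_add, ← Real.exp_add, mul_comm]
        congr 2
        ring
  · have hd : HasDerivAt (fun s : ℝ => Real.exp (((y i - μ i) * s) / σ ^ 2 - s ^ 2 / (2 * σ ^ 2)))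
        ((y i - μ i) / σ ^ 2) 0 := by
      have h1 : HasDerivAt (fun s : ℝ => ((y i - μ i) * s) / σ ^ 2 - s ^ 2 / (2 * σ ^ 2))
          (((y i - μ i) * 1) / σ ^ 2 - (2 * (0:ℝ) ^ (2 - 1) * 1) / (2 * σ ^ 2)) 0 :=
        (((hasDerivAt_id (0:ℝ)).const_mul _).div_const _).sub
          (((hasDerivAt_id (0:ℝ)).pow 2).div_const _)
      simpa using h1.exp
    have h2 := hd.tendsto_slope_zero.comp (f := st) (x := atTop)
      (tendsto_nhdsWithin_iff.2 ⟨st_tendsto, Eventually.of_forall fun k => (st_pos k).ne'⟩)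
    refine h2.congr fun k => ?_
    simp [W, div_eq_inv_mul]

lemma ibp {n : ℕ} (μ : Fin n → ℝ) (σ : ℝ) (hσ : 0 < σ) (i : Fin n) (k : ℕ)
    {u : (Fin n → ℝ) → ℝ} (hu : Good (G μ σ) (fun _ => u) u) :
    ∫ y, (u (sh i (st k) y) - u y) / st k ∂(G μ σ) = ∫ y, u y * W μ σ i (st k) y ∂(G μ σ) := by
  have hs := st_pos k
  have h1 := (hu.shiftFixed i (st k) (by rw [abs_of_pos hs]; exact st_le k)).integrable
  have h2 := hu.integrable
  have h3 := (hu.mul ((W_good (P := G μ σ) μ σ hσ i).fixed k)).integrable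
  rw [integral_div, integral_sub h1 h2, G, integral_shift μ σ hσ i (st k) u, ← G,
    div_eq_iff hs.ne', ← integral_mul_const, sub_eq_iff_eq_add, ← integral_add (h3.mul_const _) h2]
  refine integral_congr_ae (ae_of_all _ fun y => ?_)
  simp only [W]
  field_simp
  ring

/-- difference quotient -/
noncomputable def D {n : ℕ} (i : Fin n) (k : ℕ) (u : (Fin n → ℝ) → ℝ) (y : Fin n → ℝ) : ℝ :=
  (u (sh i (st k) y) - u y) / st k

structure Dif {n : ℕ} (P : Measure (Fin n → ℝ)) (i : Fin n) (u u' : (Fin n → ℝ) → ℝ) : Prop where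
  good : Good P (fun _ => u) u
  dgood : Good P (fun k => D i k u) u'

namespace Dif
variable {n : ℕ} {P : Measure (Fin n → ℝ)} {i : Fin n} {u u' v v' : (Fin n → ℝ) → ℝ}

lemma tgood (h : Dif P i u u') : Good P (fun k y => u (sh i (st k) y)) u := by
  convert h.good.add (Good.step.mul h.dgood) using 3 with k y y
  · have := (st_pos k).ne'
    simp only [D]; field_simp; ring
  · ring

lemma add (h : Dif P i u u') (h' : Dif P i v v') :
    Dif P i (fun y => u y + v y) (fun y => u' y + v' y) := by
  refine ⟨h.good.add h'.good, ?_⟩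
  convert h.dgood.add h'.dgood using 3
  simp only [D]; ring

lemma mul (h : Dif P i u u') (h' : Dif P i v v') :
    Dif P i (fun y => u y * v y) (fun y => u' y * v y + u y * v' y) := by
  refine ⟨h.good.mul h'.good, ?_⟩
  convert (h.dgood.mul h'.tgood).add (h.good.mul h'.dgood) using 3
  simp only [D]; ring

lemma const (c : ℝ) : Dif P i (fun _ => c) (fun _ => 0) := by
  refine ⟨Good.const c, ?_⟩
  convert Good.const (P := P) 0 using 3
  simp [D]

lemma coord (j : Fin n) : Dif P i (fun y => y j) (fun _ => if i = j then 1 else 0) := by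
  refine ⟨⟨fun k => measurable_pi_apply j, UB.of 1 1 fun k y => ?_,
    ae_of_all _ fun y => tendsto_const_nhds⟩, ?_⟩
  · have := abs_coord_le y j
    have := Real.add_one_le_exp (N y)
    simp; linarith
  · convert Good.const (P := P) (if i = j then 1 else 0) using 3 with k y
    have := (st_pos k).ne'
    split_ifs with h
    · subst h; simp [D, sh, this]
    · simp [D, sh, Pi.single_eq_of_ne' h]

lemma stein {μ : Fin n → ℝ} {σ : ℝ} (hσ : 0 < σ) (h : Dif (G μ σ) i u u') :
    ∫ y, u y * (y i - μ i) ∂(G μ σ) = σ ^ 2 * ∫ y, u' y ∂(G μ σ) := by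
  have h1 := h.dgood.tendsto_integral
  have h2 := (h.good.mul (W_good (P := G μ σ) μ σ hσ i)).tendsto_integral
  have h3 := tendsto_nhds_unique (h1.congr fun k => ibp μ σ hσ i k h.good) h2
  rw [h3, ← integral_const_mul]
  refine integral_congr_ae (ae_of_all _ fun y => ?_)
  simp only
  field_simp

end Dif

lemma discrete_null {n : ℕ} (i j : Fin n) (k : ℕ) (p q : (Fin n → ℝ) → ℝ) (y : Fin n → ℝ) :
    D i k (fun z => p z * D j k q z) y - D j k (fun z => p z * D i k q z) y =
      D i k p y * D j k q (sh i (st k) y) - D j k p y * D i k q (sh j (st k) y) := by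
  simp only [D]
  rw [sh_comm j i]
  ring

structure PA {n : ℕ} (P : Measure (Fin n → ℝ)) (h : (Fin n → ℝ) → Fin n → ℝ)
    (J : (Fin n → ℝ) → Fin n → Fin n → ℝ) : Prop where
  dif : ∀ i j, Dif P i (fun y => h y j) (fun y => J y i j)
  sgood : ∀ i j l, Good P (fun k y => D j k (fun z => h z l) (sh i (st k) y)) (fun y => J y j l)

namespace PA
variable {n : ℕ} {μ : Fin n → ℝ} {σ : ℝ} {h : (Fin n → ℝ) → Fin n → ℝ}
    {J : (Fin n → ℝ) → Fin n → Fin n → ℝ}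

lemma second (hσ : 0 < σ) (H : PA (G μ σ) h J) (i j : Fin n) :
    σ ^ 2 * (∫ y, J y i j * J y j i ∂(G μ σ) - ∫ y, J y i i * J y j j ∂(G μ σ)) =
      ∫ y, h y j * J y j i * (y i - μ i) ∂(G μ σ)
        - ∫ y, J y i i * h y j * (y j - μ j) ∂(G μ σ) := by
  have gL1 := (H.dif i j).dgood.mul (H.sgood i j i)
  have gL2 := (H.dif j j).dgood.mul (H.sgood j i i)
  have gR1 := ((H.dif i j).good.mul (H.dif j i).dgood).mul (W_good (P := G μ σ) μ σ hσ i)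
  have gR2 := ((H.dif i j).good.mul (H.dif i i).dgood).mul (W_good (P := G μ σ) μ σ hσ j)
  have tL := (gL1.sub gL2).tendsto_integral
  have tR := gR1.tendsto_integral.sub gR2.tendsto_integral
  have key := tendsto_nhds_unique (tR.congr fun k => ?_) tL
  · rw [integral_sub gL1.integrable gL2.integrable] at key
    have e : ∫ y, J y i i * J y j j ∂(G μ σ) = ∫ y, J y j j * J y i i ∂(G μ σ) := by
      simp only [mul_comm]
    rw [e, ← key, mul_sub, ← integral_const_mul, ← integral_const_mul]
    congr 1 <;> refine integral_congr_ae (ae_of_all _ fun y => ?_) <;> simp only <;> field_simp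
  · have u1 := ((H.dif i j).good.mul ((H.dif j i).dgood.fixed k))
    have u2 := ((H.dif i j).good.mul ((H.dif i i).dgood.fixed k))
    rw [← ibp μ σ hσ i k u1, ← ibp μ σ hσ j k u2, ← integral_sub]
    · refine integral_congr_ae (ae_of_all _ fun y => ?_)
      exact discrete_null i j k (fun z => h z j) (fun z => h z i) y
    · have hs : |st k| ≤ 1 := by rw [abs_of_pos (st_pos k)]; exact st_le k
      exact (((u1.shiftFixed i (st k) hs).sub u1).integrable).div_const _
    · have hs : |st k| ≤ 1 := by rw [abs_of_pos (st_pos k)]; exact st_le k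
      exact (((u2.shiftFixed j (st k) hs).sub u2).integrable).div_const _

lemma wgood (j i : Fin n) : Dif (G μ σ) i (fun y => y j - μ j) (fun _ => if i = j then 1 else 0) := by
  convert (Dif.coord (P := G μ σ) (i := i) j).add (Dif.const (-μ j)) using 2
  · ring
  · simp

lemma main (hσ : 0 < σ) (H : PA (G μ σ) h J) :
    ∫ y, (∑ i, h y i * (y i - μ i) - σ ^ 2 * ∑ i, J y i i) ^ 2 ∂(G μ σ) =
      σ ^ 2 * ∑ i, ∫ y, h y i ^ 2 ∂(G μ σ) + σ ^ 4 * ∑ i, ∑ j, ∫ y, J y i j * J y j i ∂(G μ σ) := by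
  have gh := fun i : Fin n => (H.dif i i).good
  have gJ := fun i j : Fin n => (H.dif i j).dgood
  have gw := fun i : Fin n => (wgood (μ := μ) (σ := σ) i i).good
  have i1 := fun i j : Fin n => (((((gh i).mul (gh j)).mul (gw j)).mul (gw i))).integrable
  have i2 := fun i j : Fin n => (((gJ i i).mul (gh j)).mul (gw j)).integrable
  have i3 := fun i j : Fin n => ((gJ i i).mul (gJ j j)).integrable
  have i4 := fun i j : Fin n => (((gh i).mul (gJ i j)).mul (gw j)).integrable
  have i5 := fun i j : Fin n => ((gh i).mul (gh j)).integrable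
  have e1 : ∀ i j : Fin n, ∫ y, h y i * h y j * (y j - μ j) * (y i - μ i) ∂(G μ σ) =
      σ ^ 2 * (∫ y, J y i i * h y j * (y j - μ j) ∂(G μ σ)
        + ∫ y, h y i * J y i j * (y j - μ j) ∂(G μ σ)
        + if i = j then ∫ y, h y i ^ 2 ∂(G μ σ) else 0) := by
    intro i j
    rw [(((H.dif i i).mul (H.dif i j)).mul (wgood j i)).stein hσ, ← integral_add (i2 i j) (i4 i j)]
    congr 1
    split_ifs with hij
    · subst hij
      have := i5 i i
      simp only [← pow_two] at this
      have i24 : Integrable (fun y => J y i i * h y i * (y i - μ i) + h y i * J y i i * (y i - μ i))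
        (G μ σ) := (i2 i i).add (i4 i i)
      rw [← integral_add i24 this]
      refine integral_congr_ae (ae_of_all _ fun y => ?_)
      simp; ring
    · rw [add_zero]
      refine integral_congr_ae (ae_of_all _ fun y => ?_)
      simp; ring
  have e0 : ∀ y, (∑ i, h y i * (y i - μ i) - σ ^ 2 * ∑ i, J y i i) ^ 2 =
      ∑ i, ∑ j, (h y i * h y j * (y j - μ j) * (y i - μ i)
        - 2 * σ ^ 2 * (J y i i * h y j * (y j - μ j)) + σ ^ 4 * (J y i i * J y j j)) := by
    intro y
    have a1 : (∑ i, h y i * (y i - μ i)) * (∑ j, h y j * (y j - μ j)) =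
      ∑ i, ∑ j, h y i * h y j * (y j - μ j) * (y i - μ i) := by
      rw [Finset.sum_mul_sum]
      exact Finset.sum_congr rfl fun i _ => Finset.sum_congr rfl fun j _ => by ring
    have a2 : (∑ i, J y i i) * (∑ j, h y j * (y j - μ j)) =
      ∑ i, ∑ j, J y i i * h y j * (y j - μ j) := by
      rw [Finset.sum_mul_sum]
      exact Finset.sum_congr rfl fun i _ => Finset.sum_congr rfl fun j _ => by ring
    have a3 : (∑ i, J y i i) * (∑ j, J y j j) = ∑ i, ∑ j, J y i i * J y j j := by
      rw [Finset.sum_mul_sum]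
    have a4 : ∑ i, ∑ j, (h y i * h y j * (y j - μ j) * (y i - μ i)
        - 2 * σ ^ 2 * (J y i i * h y j * (y j - μ j)) + σ ^ 4 * (J y i i * J y j j)) =
        ∑ i, ∑ j, h y i * h y j * (y j - μ j) * (y i - μ i)
        - 2 * σ ^ 2 * (∑ i, ∑ j, J y i i * h y j * (y j - μ j))
        + σ ^ 4 * (∑ i, ∑ j, J y i i * J y j j) := by
      simp only [Finset.sum_add_distrib, Finset.sum_sub_distrib, Finset.mul_sum]
    rw [a4, ← a1]
    rw [← a2, ← a3]
    ring
  have ii : ∀ i j : Fin n, Integrable (fun y => h y i * h y j * (y j - μ j) * (y i - μ i)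
        - 2 * σ ^ 2 * (J y i i * h y j * (y j - μ j)) + σ ^ 4 * (J y i i * J y j j)) (G μ σ) :=
    fun i j => ((i1 i j).sub ((i2 i j).const_mul _)).add ((i3 i j).const_mul _)
  simp_rw [e0]
  rw [integral_finsetSum _ fun i _ => integrable_finsetSum _ fun j _ => ii i j]
  have e2 : ∀ i j : Fin n, ∫ y, (h y i * h y j * (y j - μ j) * (y i - μ i)
        - 2 * σ ^ 2 * (J y i i * h y j * (y j - μ j)) + σ ^ 4 * (J y i i * J y j j)) ∂(G μ σ) =
      (σ ^ 2 * (if i = j then ∫ y, h y i ^ 2 ∂(G μ σ) else 0)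
        + σ ^ 4 * ∫ y, J y i j * J y j i ∂(G μ σ))
        + (σ ^ 2 * ∫ y, h y i * J y i j * (y j - μ j) ∂(G μ σ)
        - σ ^ 2 * ∫ y, h y j * J y j i * (y i - μ i) ∂(G μ σ)) := by
    intro i j
    have i12 : Integrable (fun y => h y i * h y j * (y j - μ j) * (y i - μ i)
        - 2 * σ ^ 2 * (J y i i * h y j * (y j - μ j))) (G μ σ) :=
      (i1 i j).sub ((i2 i j).const_mul _)
    rw [integral_add i12 ((i3 i j).const_mul _),
      integral_sub (i1 i j) ((i2 i j).const_mul _), integral_const_mul, integral_const_mul, e1]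
    have := H.second hσ i j
    linear_combination (-σ ^ 2) * this
  have e3 : ∀ i : Fin n, ∫ y, ∑ j, (h y i * h y j * (y j - μ j) * (y i - μ i)
        - 2 * σ ^ 2 * (J y i i * h y j * (y j - μ j)) + σ ^ 4 * (J y i i * J y j j)) ∂(G μ σ) =
      ∑ j, ((σ ^ 2 * (if i = j then ∫ y, h y i ^ 2 ∂(G μ σ) else 0)
        + σ ^ 4 * ∫ y, J y i j * J y j i ∂(G μ σ))
        + (σ ^ 2 * ∫ y, h y i * J y i j * (y j - μ j) ∂(G μ σ)
        - σ ^ 2 * ∫ y, h y j * J y j i * (y i - μ i) ∂(G μ σ))) := by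
    intro i
    rw [integral_finsetSum _ fun j _ => ii i j]
    exact Finset.sum_congr rfl fun j _ => e2 i j
  simp_rw [e3, Finset.sum_add_distrib, Finset.sum_sub_distrib]
  rw [Finset.sum_comm (f := fun i j => σ ^ 2 * ∫ y, h y j * J y j i * (y i - μ i) ∂(G μ σ))]
  simp [Finset.mul_sum]

end PA

/-- Locally affine a.e. and Lipschitz maps are PA. -/
lemma PA.of {n : ℕ} {P : Measure (Fin n → ℝ)} {h : (Fin n → ℝ) → Fin n → ℝ}
    {J : (Fin n → ℝ) → Fin n → Fin n → ℝ} (hm : Measurable h) (L : ℝ)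
    (hL : ∀ y z j, |h y j - h z j| ≤ L * N (y - z))
    (hJ : ∀ᵐ y ∂P, ∀ᶠ z in 𝓝 y, ∀ j, h z j = h y j + ∑ i, J y i j * (z i - y i)) :
    PA P h J := by
  have hmj : ∀ j, Measurable fun y => h y j := fun j => (measurable_pi_apply j).comp hm
  have hDm : ∀ i k j, Measurable (D i k fun z => h z j) := fun i k j =>
    (((hmj j).comp (measurable_sh i _)).sub (hmj j)).div_const _
  have hDb : ∀ i k j y, |D i k (fun z => h z j) y| ≤ L := by
    intro i k j y
    have hs := st_pos k
    rw [D, abs_div, abs_of_pos hs, div_le_iff₀ hs]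
    refine (hL _ _ j).trans (le_of_eq ?_)
    congr 1
    have : sh i (st k) y - y = Pi.single i (st k) := by simp [sh]
    rw [this, N, Finset.sum_eq_single i]
    · simp [abs_of_pos hs]
    · intro l _ hl; simp [hl]
    · simp
  have hcs : ∀ i, Continuous fun s : ℝ => (Pi.single i s : Fin n → ℝ) :=
    fun i => continuous_single (A := fun _ => ℝ) i
  have hsht : ∀ i (y : Fin n → ℝ), Tendsto (fun k => sh i (st k) y) atTop (𝓝 y) := by
    intro i y
    have hc : Continuous fun s : ℝ => sh i s y := by
      unfold sh
      exact continuous_const.add (hcs i)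
    have := (hc.tendsto 0).comp st_tendsto
    simpa [sh, Function.comp_def] using this
  have hsht2 : ∀ i j (y : Fin n → ℝ), Tendsto (fun k => sh j (st k) (sh i (st k) y)) atTop (𝓝 y) := by
    intro i j y
    have hc : Continuous fun s : ℝ => sh j s (sh i s y) := by
      unfold sh
      exact (continuous_const.add (hcs i)).add (hcs j)
    have := (hc.tendsto 0).comp st_tendsto
    simpa [sh, Function.comp_def] using this
  have hdiff : ∀ (y z : Fin n → ℝ) (i j : Fin n) (s : ℝ),
      ∑ l, J y l j * (sh i s z l - y l) - ∑ l, J y l j * (z l - y l) = J y i j * s := by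
    intro y z i j s
    rw [← Finset.sum_sub_distrib, Finset.sum_eq_single i]
    · simp [sh]; ring
    · intro l _ hl; simp [sh, hl]
    · simp
  constructor
  · intro i j
    refine ⟨⟨fun _ => hmj j, ?_, ae_of_all _ fun y => tendsto_const_nhds⟩, fun k => hDm i k j,
      UB.of L 0 (by intro k y; simpa using hDb i k j y), ?_⟩
    · refine UB.of (|h 0 j| + |L|) 1 fun k y => ?_
      have h1 := hL y 0 j
      rw [sub_zero] at h1
      have h2 := Real.add_one_le_exp (N y)
      have h3 := N_nonneg y
      have h4 : L * N y ≤ |L| * N y := by gcongr; exact le_abs_self L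
      have h5 : |h y j| ≤ |h y j - h 0 j| + |h 0 j| := by
        have := abs_add_le (h y j - h 0 j) (h 0 j); simpa using this
      have h6 := abs_nonneg (h 0 j)
      have h7 := abs_nonneg L
      rw [one_mul]
      nlinarith
    · filter_upwards [hJ] with y hy
      refine tendsto_const_nhds.congr' ?_
      filter_upwards [(hsht i y).eventually hy] with k hk
      have e := hdiff y y i j (st k)
      have hs := (st_pos k).ne'
      rw [D, hk j, eq_div_iff hs, ← e]
      simp
  · intro i j l
    refine ⟨fun k => (hDm j k l).comp (measurable_sh i _),
      UB.of L 0 (by intro k y; simpa using hDb j k l _), ?_⟩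
    filter_upwards [hJ] with y hy
    refine tendsto_const_nhds.congr' ?_
    filter_upwards [(hsht i y).eventually hy, (hsht2 i j y).eventually hy] with k hk hk2
    have e := hdiff y (sh i (st k) y) j l (st k)
    have hs := (st_pos k).ne'
    rw [D, hk l, hk2 l, eq_div_iff hs, ← e]
    ring

/-- the image `A x` -/
noncomputable def Ax {n p : ℕ} (a : Fin p → Fin n → ℝ) (x : Fin p → ℝ) (j : Fin n) : ℝ :=
  ∑ i, x i * a i j

/-- the correlation of column i with the residual -/
noncomputable def cor {n p : ℕ} (a : Fin p → Fin n → ℝ) (z : Fin n → ℝ) (x : Fin p → ℝ)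
    (i : Fin p) : ℝ := ∑ j, a i j * (z j - Ax a x j)

lemma sum_Ax_mul {n p : ℕ} (a : Fin p → Fin n → ℝ) (d : Fin p → ℝ) (r : Fin n → ℝ) :
    ∑ j, Ax a d j * r j = ∑ i, d i * ∑ j, a i j * r j := by
  simp only [Ax, Finset.sum_mul, Finset.mul_sum]
  rw [Finset.sum_comm]
  exact Finset.sum_congr rfl fun i _ => Finset.sum_congr rfl fun j _ => by ring

lemma Ax_add {n p : ℕ} (a : Fin p → Fin n → ℝ) (x d : Fin p → ℝ) (j : Fin n) :
    Ax a (x + d) j = Ax a x j + Ax a d j := by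
  simp [Ax, add_mul, Finset.sum_add_distrib]

lemma Ax_smul {n p : ℕ} (a : Fin p → Fin n → ℝ) (t : ℝ) (d : Fin p → ℝ) (j : Fin n) :
    Ax a (t • d) j = t * Ax a d j := by
  simp [Ax, Finset.mul_sum, mul_assoc]

lemma obj_expand {n p : ℕ} (a : Fin p → Fin n → ℝ) (lam : ℝ) (z : Fin n → ℝ) (x d : Fin p → ℝ) :
    lassoObjPi a lam z (x + d) = lassoObjPi a lam z x + (1 / 2) * ∑ j, Ax a d j ^ 2
      - ∑ i, d i * cor a z x i + lam * ∑ i, (|x i + d i| - |x i|) := by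
  have h1 : ∑ i, d i * cor a z x i = ∑ j, Ax a d j * (z j - Ax a x j) :=
    (sum_Ax_mul a d (fun j => z j - Ax a x j)).symm
  rw [h1]
  change (1 / 2) * ∑ j, (z j - Ax a (x + d) j) ^ 2 + lam * ∑ i, |x i + d i| =
    ((1 / 2) * ∑ j, (z j - Ax a x j) ^ 2 + lam * ∑ i, |x i|) + (1 / 2) * ∑ j, Ax a d j ^ 2
      - ∑ j, Ax a d j * (z j - Ax a x j) + lam * ∑ i, (|x i + d i| - |x i|)
  have h2 : ∑ j, (z j - Ax a (x + d) j) ^ 2 = ∑ j, (z j - Ax a x j) ^ 2 + ∑ j, Ax a d j ^ 2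
      - 2 * ∑ j, Ax a d j * (z j - Ax a x j) := by
    rw [Finset.mul_sum, ← Finset.sum_add_distrib, ← Finset.sum_sub_distrib]
    refine Finset.sum_congr rfl fun j _ => ?_
    rw [Ax_add]; ring
  rw [h2, Finset.sum_sub_distrib]
  ring

lemma Ax_single {n p : ℕ} (a : Fin p → Fin n → ℝ) (i : Fin p) (t : ℝ) (j : Fin n) :
    Ax a (Pi.single i t) j = t * a i j := by
  rw [Ax, Finset.sum_eq_single i]
  · simp
  · intro l _ hl; simp [hl]
  · simp

lemma kkt {n p : ℕ} (a : Fin p → Fin n → ℝ) {lam : ℝ} (hlam : 0 < lam) (z : Fin n → ℝ) (x : Fin p → ℝ) :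
    IsLassoSolPi a lam z x ↔
      (∀ i, |cor a z x i| ≤ lam) ∧ ∀ i, x i * cor a z x i = lam * |x i| := by
  constructor
  · intro h
    have key : ∀ i t, t * cor a z x i ≤ t ^ 2 * ((1 / 2) * ∑ j, a i j ^ 2)
        + lam * (|x i + t| - |x i|) := by
      intro i t
      have h1 := h (x + Pi.single i t)
      rw [obj_expand] at h1
      have h2 : ∑ l, (Pi.single i t : Fin p → ℝ) l * cor a z x l = t * cor a z x i := by
        rw [Finset.sum_eq_single i]
        · simp
        · intro l _ hl; simp [hl]
        · simp
      have h3 : ∑ l, (|x l + (Pi.single i t : Fin p → ℝ) l| - |x l|) = |x i + t| - |x i| := by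
        rw [Finset.sum_eq_single i]
        · simp
        · intro l _ hl; simp [hl]
        · simp
      have h4 : ∑ j, Ax a (Pi.single i t) j ^ 2 = t ^ 2 * ∑ j, a i j ^ 2 := by
        rw [Finset.mul_sum]
        exact Finset.sum_congr rfl fun j _ => by rw [Ax_single]; ring
      rw [h2, h3, h4] at h1
      linarith
    have lim : ∀ A B q : ℝ, (∀ ε : ℝ, 0 < ε → ε < 1 → ε * A ≤ ε ^ 2 * q + ε * B) → A ≤ B := by
      intro A B q hq
      by_contra hAB
      push Not at hAB
      set e := min (1 / 2) ((A - B) / (2 * (|q| + 1))) with he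
      have hq0 : 0 < |q| + 1 := by positivity
      have he0 : 0 < e := lt_min (by norm_num) (div_pos (by linarith) (by positivity))
      have he1 : e < 1 := (min_le_left _ _).trans_lt (by norm_num)
      have he2 : e * (|q| + 1) ≤ (A - B) / 2 := by
        have : e ≤ (A - B) / (2 * (|q| + 1)) := min_le_right _ _
        rw [le_div_iff₀ (by positivity)] at this
        linarith
      have h1 := hq e he0 he1
      have h2 : A ≤ e * q + B := by
        have : e * A ≤ e * (e * q + B) := by linarith [h1, show e * (e * q + B) = e ^ 2 * q + e * B by ring]
        exact le_of_mul_le_mul_left this he0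
      have h3 : e * q ≤ e * |q| := by gcongr; exact le_abs_self q
      nlinarith
    have up : ∀ i (s : ℝ), |s| = 1 → s * cor a z x i ≤ lam := by
      intro i s hs
      refine lim _ _ ((1 / 2) * ∑ j, a i j ^ 2) fun ε h0 h1 => ?_
      have := key i (ε * s)
      have hs2 : s ^ 2 = 1 := by rw [← sq_abs, hs]; norm_num
      have h6 : |x i + ε * s| - |x i| ≤ ε := by
        have := abs_add_le (x i) (ε * s)
        rw [abs_mul, hs, abs_of_pos h0] at this
        linarith
      have h7 : lam * (|x i + ε * s| - |x i|) ≤ lam * ε := by gcongr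
      have h8 : (ε * s) ^ 2 = ε ^ 2 := by rw [mul_pow, hs2, mul_one]
      rw [h8] at this
      linarith
    have hc : ∀ i, |cor a z x i| ≤ lam := by
      intro i
      rw [abs_le]
      have h1 := up i 1 (by simp)
      have h2 := up i (-1) (by simp)
      constructor <;> linarith
    refine ⟨hc, fun i => le_antisymm ?_ ?_⟩
    · calc x i * cor a z x i ≤ |x i * cor a z x i| := le_abs_self _
          _ = |x i| * |cor a z x i| := abs_mul _ _
          _ ≤ |x i| * lam := by gcongr; exact hc i
          _ = _ := mul_comm _ _
    · refine lim _ _ (x i ^ 2 * ((1 / 2) * ∑ j, a i j ^ 2)) fun ε h0 h1 => ?_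
      have := key i (-ε * x i)
      have h2 : |x i + -ε * x i| = (1 - ε) * |x i| := by
        rw [show x i + -ε * x i = (1 - ε) * x i by ring, abs_mul, abs_of_pos (by linarith)]
      rw [h2] at this
      linarith
  · rintro ⟨h1, h2⟩ x'
    have e : x' = x + (x' - x) := by abel
    rw [e, obj_expand]
    have h3 : ∑ i, (x' - x) i * cor a z x i ≤ lam * ∑ i, (|x i + (x' - x) i| - |x i|) := by
      rw [Finset.mul_sum]
      refine Finset.sum_le_sum fun i _ => ?_
      have h4 : x' i * cor a z x i ≤ lam * |x' i| := by
        calc x' i * cor a z x i ≤ |x' i * cor a z x i| := le_abs_self _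
          _ = |x' i| * |cor a z x i| := abs_mul _ _
          _ ≤ |x' i| * lam := by gcongr; exact h1 i
          _ = _ := mul_comm _ _
      have := h2 i
      simp only [Pi.sub_apply, add_sub_cancel]
      linarith
    have h5 : 0 ≤ ∑ j, Ax a (x' - x) j ^ 2 := Finset.sum_nonneg fun j _ => sq_nonneg _
    linarith

lemma mono_sol {n p : ℕ} (a : Fin p → Fin n → ℝ) {lam : ℝ} (hlam : 0 < lam) {z z' : Fin n → ℝ}
    {x x' : Fin p → ℝ} (h : IsLassoSolPi a lam z x) (h' : IsLassoSolPi a lam z' x') :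
    ∑ j, (Ax a x j - Ax a x' j) ^ 2 ≤ ∑ j, (Ax a x j - Ax a x' j) * (z j - z' j) := by
  obtain ⟨h1, h2⟩ := (kkt a hlam z x).1 h
  obtain ⟨h1', h2'⟩ := (kkt a hlam z' x').1 h'
  have aux : ∀ s c : ℝ, |c| ≤ lam → s * c ≤ lam * |s| := fun s c hc => by
    calc s * c ≤ |s * c| := le_abs_self _
      _ = |s| * |c| := abs_mul _ _
      _ ≤ |s| * lam := by gcongr
      _ = _ := mul_comm _ _
  have e1 : ∑ j, Ax a x j * (z j - Ax a x j) = ∑ i, x i * cor a z x i :=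
    sum_Ax_mul a x (fun j => z j - Ax a x j)
  have e2 : ∑ j, Ax a x' j * (z j - Ax a x j) = ∑ i, x' i * cor a z x i :=
    sum_Ax_mul a x' (fun j => z j - Ax a x j)
  have e3 : ∑ j, Ax a x j * (z' j - Ax a x' j) = ∑ i, x i * cor a z' x' i :=
    sum_Ax_mul a x (fun j => z' j - Ax a x' j)
  have e4 : ∑ j, Ax a x' j * (z' j - Ax a x' j) = ∑ i, x' i * cor a z' x' i :=
    sum_Ax_mul a x' (fun j => z' j - Ax a x' j)
  have f1 : ∑ i, x' i * cor a z x i ≤ ∑ i, x' i * cor a z' x' i :=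
    Finset.sum_le_sum fun i _ => by rw [h2' i]; exact aux _ _ (h1 i)
  have f2 : ∑ i, x i * cor a z' x' i ≤ ∑ i, x i * cor a z x i :=
    Finset.sum_le_sum fun i _ => by rw [h2 i]; exact aux _ _ (h1' i)
  have e5 : ∑ j, (Ax a x j - Ax a x' j) * (z j - z' j) - ∑ j, (Ax a x j - Ax a x' j) ^ 2 =
      ∑ j, Ax a x j * (z j - Ax a x j) - ∑ j, Ax a x' j * (z j - Ax a x j)
      - ∑ j, Ax a x j * (z' j - Ax a x' j) + ∑ j, Ax a x' j * (z' j - Ax a x' j) := by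
    simp only [← Finset.sum_add_distrib, ← Finset.sum_sub_distrib]
    exact Finset.sum_congr rfl fun j _ => by ring
  linarith

lemma Ax_unique {n p : ℕ} (a : Fin p → Fin n → ℝ) {lam : ℝ} (hlam : 0 < lam) {z : Fin n → ℝ}
    {x x' : Fin p → ℝ} (h : IsLassoSolPi a lam z x) (h' : IsLassoSolPi a lam z x') (j : Fin n) :
    Ax a x j = Ax a x' j := by
  have h1 := mono_sol a hlam h h'
  simp only [sub_self, mul_zero, Finset.sum_const_zero] at h1
  have h2 : ∑ j, (Ax a x j - Ax a x' j) ^ 2 = 0 :=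
    le_antisymm h1 (Finset.sum_nonneg fun _ _ => sq_nonneg _)
  rw [Finset.sum_eq_zero_iff_of_nonneg (fun _ _ => sq_nonneg _)] at h2
  have := h2 j (Finset.mem_univ j)
  nlinarith [pow_eq_zero_iff (two_ne_zero) |>.1 this]

lemma lip_sol {n p : ℕ} (a : Fin p → Fin n → ℝ) {lam : ℝ} (hlam : 0 < lam) {z z' : Fin n → ℝ}
    {x x' : Fin p → ℝ} (h : IsLassoSolPi a lam z x) (h' : IsLassoSolPi a lam z' x') (j : Fin n) :
    |Ax a x j - Ax a x' j| ≤ ∑ j, |z j - z' j| := by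
  have h1 := mono_sol a hlam h h'
  have h2 : ∑ j, (Ax a x j - Ax a x' j) * (z j - z' j) ≤
      (1 / 2) * ∑ j, (Ax a x j - Ax a x' j) ^ 2 + (1 / 2) * ∑ j, (z j - z' j) ^ 2 := by
    rw [Finset.mul_sum, Finset.mul_sum, ← Finset.sum_add_distrib]
    refine Finset.sum_le_sum fun j _ => ?_
    nlinarith [sq_nonneg ((Ax a x j - Ax a x' j) - (z j - z' j))]
  have h3 : (Ax a x j - Ax a x' j) ^ 2 ≤ ∑ j, (Ax a x j - Ax a x' j) ^ 2 :=
    Finset.single_le_sum (f := fun j => (Ax a x j - Ax a x' j) ^ 2) (fun _ _ => sq_nonneg _)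
      (Finset.mem_univ j)
  have h4 : ∑ j, (z j - z' j) ^ 2 ≤ (∑ j, |z j - z' j|) ^ 2 := by
    have := Finset.sum_sq_le_sq_sum_of_nonneg (s := Finset.univ) (f := fun j => |z j - z' j|)
      (fun _ _ => abs_nonneg _)
    simpa only [sq_abs] using this
  exact abs_le_of_sq_le_sq (by linarith) (Finset.sum_nonneg fun _ _ => abs_nonneg _)

lemma exists_smaller {n p : ℕ} (a : Fin p → Fin n → ℝ) {lam : ℝ} (hlam : 0 < lam) {z : Fin n → ℝ}
    {x v : Fin p → ℝ} (h : IsLassoSolPi a lam z x) (hv : ∀ i, x i = 0 → v i = 0)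
    (hAv : ∀ j, Ax a v j = 0) (hne : ∃ i, v i * x i < 0) :
    ∃ x', IsLassoSolPi a lam z x' ∧ {i | x' i ≠ 0}.ncard < {i | x i ≠ 0}.ncard := by
  obtain ⟨h1, h2⟩ := (kkt a hlam z x).1 h
  obtain ⟨i1, hi1⟩ := hne
  obtain ⟨i0, hi0, hmin⟩ := Finset.exists_min_image (Finset.univ.filter fun i => v i * x i < 0)
    (fun i => - x i / v i) ⟨i1, by simpa using hi1⟩
  simp only [Finset.mem_filter, Finset.mem_univ, true_and] at hi0 hmin
  set t := - x i0 / v i0 with ht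
  have hv0 : v i0 ≠ 0 := by rintro h0; simp [h0] at hi0
  have hx0 : x i0 ≠ 0 := by rintro h0; simp [h0] at hi0
  have htpos : 0 < t := by
    have : t = - (v i0 * x i0) / (v i0) ^ 2 := by rw [ht]; field_simp
    rw [this]
    exact div_pos (by linarith) (by positivity)
  have hz : x i0 + t * v i0 = 0 := by rw [ht]; field_simp; ring
  refine ⟨x + t • v, (kkt a hlam z _).2 ?_, ?_⟩
  · have hcor : ∀ i, cor a z (x + t • v) i = cor a z x i := by
      intro i
      simp only [cor, Ax_add, Ax_smul, hAv, mul_zero, add_zero]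
    refine ⟨fun i => by rw [hcor]; exact h1 i, fun i => ?_⟩
    rw [hcor]
    simp only [Pi.add_apply, Pi.smul_apply, smul_eq_mul]
    rcases eq_or_ne (x i) 0 with hxi | hxi
    · simp [hxi, hv i hxi]
    have hsame : 0 ≤ x i * (x i + t * v i) := by
      rcases lt_or_ge (v i * x i) 0 with hneg | hpos
      · have h3 := hmin i hneg
        have hvi : v i ≠ 0 := by rintro h0; simp [h0] at hneg
        have e : - x i / v i = (x i) ^ 2 / (-(v i * x i)) := by
          have : v i * x i ≠ 0 := hneg.ne
          field_simp
        rw [e, le_div_iff₀ (by linarith)] at h3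
        nlinarith
      · nlinarith [sq_nonneg (x i), mul_nonneg htpos.le hpos]
    have h3 := h2 i
    rcases lt_or_gt_of_ne hxi with hn | hp
    · rw [abs_of_neg hn] at h3
      have hc : cor a z x i = -lam := by
        have : x i * cor a z x i = x i * (-lam) := by rw [h3]; ring
        exact mul_left_cancel₀ hxi this
      rw [hc, abs_of_nonpos (by nlinarith)]; ring
    · rw [abs_of_pos hp] at h3
      have hc : cor a z x i = lam := by
        have : x i * cor a z x i = x i * lam := by rw [h3]; ring
        exact mul_left_cancel₀ hxi this
      rw [hc, abs_of_nonneg (by nlinarith)]; ring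
  · refine Set.ncard_lt_ncard ?_ (Set.toFinite _)
    rw [Set.ssubset_iff_of_subset]
    · exact ⟨i0, hx0, by simpa using hz⟩
    · intro i hi hxi
      exact hi (by simp [hxi, hv i hxi])

lemma indep_of_min {n p : ℕ} (a : Fin p → Fin n → ℝ) {lam : ℝ} (hlam : 0 < lam) {z : Fin n → ℝ}
    {x : Fin p → ℝ} (h : IsLassoSolPi a lam z x)
    (hmin : ∀ x', IsLassoSolPi a lam z x' → {i | x i ≠ 0}.ncard ≤ {i | x' i ≠ 0}.ncard) :
    LinearIndepOn ℝ a (↑(Finset.univ.filter fun i => x i ≠ 0) : Set (Fin p)) := by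
  rw [linearIndepOn_finset_iff]
  intro g hg
  set v : Fin p → ℝ := fun i => if x i ≠ 0 then g i else 0 with hvdef
  have hAv : ∀ j, Ax a v j = 0 := by
    intro j
    have := congrFun hg j
    simp only [Finset.sum_apply, Pi.smul_apply, smul_eq_mul, Pi.zero_apply,
      Finset.sum_filter] at this
    rw [← this, Ax]
    exact Finset.sum_congr rfl fun i _ => by simp only [hvdef]; split_ifs <;> simp
  have hv0 : ∀ i, x i = 0 → v i = 0 := fun i hi => by simp [hvdef, hi]
  have hnn : ∀ i, ¬ v i * x i < 0 := fun i hi => by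
    obtain ⟨x', h1, h2⟩ := exists_smaller a hlam h hv0 hAv ⟨i, hi⟩
    exact absurd (hmin x' h1) (not_le.2 h2)
  have hnn' : ∀ i, ¬ (-v) i * x i < 0 := fun i hi => by
    obtain ⟨x', h1, h2⟩ := exists_smaller a hlam h (v := -v) (fun i hi => by simp [hv0 i hi])
      (fun j => by
        have := Ax_smul a (-1) v j
        rw [hAv j] at this
        simpa using this) ⟨i, hi⟩
    exact absurd (hmin x' h1) (not_le.2 h2)
  intro i hi
  simp only [Finset.mem_filter, Finset.mem_univ, true_and] at hi
  have h1 := hnn i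
  have h2 := hnn' i
  simp only [Pi.neg_apply] at h2
  have h3 : v i * x i = 0 := by linarith
  have h4 : v i = 0 := (mul_eq_zero.1 h3).resolve_right hi
  simpa [hvdef, hi] using h4

lemma exists_proj {n p : ℕ} (a : Fin p → Fin n → ℝ) (S : Finset (Fin p))
    (hS : LinearIndepOn ℝ a (S : Set (Fin p))) :
    ∃ Q : Fin n → Fin n → ℝ, ∑ i, Q i i = S.card ∧ ∑ i, ∑ j, Q i j * Q j i = S.card ∧
      ∀ (x : Fin p → ℝ) (e : Fin n → ℝ), (∀ i, i ∉ S → x i = 0) →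
        (∀ i ∈ S, ∑ j, a i j * (e j - Ax a x j) = 0) → ∀ j, Ax a x j = ∑ i, Q i j * e i := by
  let c : S → EuclideanSpace ℝ (Fin n) := fun i => WithLp.toLp 2 (a i)
  have hc : LinearIndependent ℝ c := by
    have h1 : LinearIndependent ℝ (fun i : S => a i) := hS
    exact h1.map' (WithLp.linearEquiv 2 ℝ (Fin n → ℝ)).symm.toLinearMap (LinearEquiv.ker _)
  let U := Submodule.span ℝ (Set.range c)
  have hU : Module.finrank ℝ U = S.card := by
    rw [finrank_span_eq_card hc, Fintype.card_coe]
  let b := stdOrthonormalBasis ℝ U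
  have hin : ∀ x y : EuclideanSpace ℝ (Fin n), inner ℝ x y = ∑ j, x j * y j := by
    intro x y
    rw [PiLp.inner_apply]
    exact Finset.sum_congr rfl fun j _ => by simp [mul_comm]
  have hb : ∀ k l, ∑ j, (b k : EuclideanSpace ℝ (Fin n)) j * (b l : EuclideanSpace ℝ (Fin n)) j =
      if k = l then 1 else 0 := by
    intro k l
    rw [← hin, ← Submodule.coe_inner]
    exact orthonormal_iff_ite.1 b.orthonormal k l
  refine ⟨fun i j => ∑ k, (b k : EuclideanSpace ℝ (Fin n)) i * (b k : EuclideanSpace ℝ (Fin n)) j,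
    ?_, ?_, ?_⟩
  · rw [Finset.sum_comm]
    simp only [hb]
    simp [hU]
  · have : ∀ i j, (∑ k, (b k : EuclideanSpace ℝ (Fin n)) i * (b k : EuclideanSpace ℝ (Fin n)) j) *
        (∑ k, (b k : EuclideanSpace ℝ (Fin n)) j * (b k : EuclideanSpace ℝ (Fin n)) i) =
        ∑ k, ∑ l, ((b k : EuclideanSpace ℝ (Fin n)) i * (b l : EuclideanSpace ℝ (Fin n)) i) *
          ((b k : EuclideanSpace ℝ (Fin n)) j * (b l : EuclideanSpace ℝ (Fin n)) j) := by
      intro i j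
      rw [Finset.sum_mul_sum]
      exact Finset.sum_congr rfl fun k _ => Finset.sum_congr rfl fun l _ => by ring
    simp only [this]
    calc _ = ∑ k, ∑ l, (∑ i, (b k : EuclideanSpace ℝ (Fin n)) i * (b l : EuclideanSpace ℝ (Fin n)) i)
          * (∑ j, (b k : EuclideanSpace ℝ (Fin n)) j * (b l : EuclideanSpace ℝ (Fin n)) j) := by
          simp only [Finset.sum_mul_sum]
          rw [Finset.sum_congr rfl fun i _ => Finset.sum_comm, Finset.sum_comm]
          refine Finset.sum_congr rfl fun k _ => ?_
          rw [Finset.sum_congr rfl fun i _ => Finset.sum_comm, Finset.sum_comm]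
      _ = _ := by simp [hb, hU]
  · intro x e hx he j
    have hmem : WithLp.toLp 2 (Ax a x) ∈ U := by
      have : WithLp.toLp 2 (Ax a x) = ∑ i : S, x i • c i := by
        ext l
        simp only [c, WithLp.ofLp_sum, WithLp.ofLp_smul, Finset.sum_apply, Pi.smul_apply,
          smul_eq_mul, Ax]
        rw [Finset.sum_coe_sort S (fun i => x i * a i l)]
        symm
        exact Finset.sum_subset (Finset.subset_univ S) fun i _ hi => by simp [hx i hi]
      rw [this]
      exact Submodule.sum_mem _ fun i _ => Submodule.smul_mem _ _ (Submodule.subset_span ⟨i, rfl⟩)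
    have hperp : ∀ u ∈ U, inner ℝ u (WithLp.toLp 2 (fun j => e j - Ax a x j)) = (0 : ℝ) := by
      intro u hu
      induction hu using Submodule.span_induction with
      | mem u hu =>
        obtain ⟨i, rfl⟩ := hu
        rw [hin]
        exact he i i.2
      | zero => simp
      | add u w _ _ h1 h2 => rw [inner_add_left, h1, h2, add_zero]
      | smul t u _ h1 => rw [inner_smul_left, h1, mul_zero]
    have hrep := b.sum_repr' ⟨_, hmem⟩
    have hrep2 := congrArg (fun u : U => (u : EuclideanSpace ℝ (Fin n)) j) hrep
    simp only [Submodule.coe_sum, Submodule.coe_smul, WithLp.ofLp_sum, WithLp.ofLp_smul,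
      Finset.sum_apply, Pi.smul_apply, smul_eq_mul, Submodule.coe_inner, hin] at hrep2
    rw [← hrep2]
    simp only [Finset.sum_mul]
    rw [Finset.sum_comm]
    rw [Finset.sum_comm]
    have h4 : ∀ k, ∑ i, (b k : EuclideanSpace ℝ (Fin n)) i * Ax a x i =
        ∑ i, (b k : EuclideanSpace ℝ (Fin n)) i * e i := by
      intro k
      have := hperp _ (b k).2
      rw [hin] at this
      simp only [mul_sub, Finset.sum_sub_distrib] at this
      linarith
    simp only [← Finset.sum_mul, h4]
    simp only [Finset.sum_mul]
    rw [Finset.sum_comm]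
    exact Finset.sum_congr rfl fun k _ => Finset.sum_congr rfl fun l _ => by ring

/-- the region of data admitting a solution with given sign pattern -/
def region {n p : ℕ} (a : Fin p → Fin n → ℝ) (lam : ℝ) (s : Fin p → SignType) :
    Set (Fin n → ℝ) :=
  {z | ∃ x, IsLassoSolPi a lam z x ∧ ∀ i, SignType.sign (x i) = s i}

lemma cor_pos {n p : ℕ} (a : Fin p → Fin n → ℝ) {lam : ℝ} (hlam : 0 < lam) {z : Fin n → ℝ}
    {x : Fin p → ℝ} (h : IsLassoSolPi a lam z x) {i : Fin p} (hi : 0 < x i) :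
    cor a z x i = lam := by
  have h3 := ((kkt a hlam z x).1 h).2 i
  rw [abs_of_pos hi] at h3
  have : x i * cor a z x i = x i * lam := by rw [h3]; ring
  exact mul_left_cancel₀ hi.ne' this

lemma cor_neg {n p : ℕ} (a : Fin p → Fin n → ℝ) {lam : ℝ} (hlam : 0 < lam) {z : Fin n → ℝ}
    {x : Fin p → ℝ} (h : IsLassoSolPi a lam z x) {i : Fin p} (hi : x i < 0) :
    cor a z x i = -lam := by
  have h3 := ((kkt a hlam z x).1 h).2 i
  rw [abs_of_neg hi] at h3
  have : x i * cor a z x i = x i * (-lam) := by rw [h3]; ring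
  exact mul_left_cancel₀ hi.ne this

lemma convex_region {n p : ℕ} (a : Fin p → Fin n → ℝ) {lam : ℝ} (hlam : 0 < lam)
    (s : Fin p → SignType) : Convex ℝ (region a lam s) := by
  rintro z ⟨x, hx, hxs⟩ z' ⟨x', hx', hxs'⟩ α β hα hβ hαβ
  have hcor : ∀ i, cor a (α • z + β • z') (α • x + β • x') i =
      α * cor a z x i + β * cor a z' x' i := by
    intro i
    simp only [cor, Ax_add, Ax_smul, Finset.mul_sum, ← Finset.sum_add_distrib]
    refine Finset.sum_congr rfl fun j _ => ?_
    simp only [Pi.add_apply, Pi.smul_apply, smul_eq_mul]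
    ring
  have hK := (kkt a hlam z x).1 hx
  have hK' := (kkt a hlam z' x').1 hx'
  have hcomb : ∀ u v : ℝ, 0 < u → 0 < v → 0 < α * u + β * v := by
    intro u v hu hv
    rcases hα.eq_or_lt with h0 | h0
    · have : β = 1 := by linarith
      rw [← h0, this]; linarith
    · nlinarith [mul_pos h0 hu, mul_nonneg hβ hv.le]
  refine ⟨α • x + β • x', (kkt a hlam _ _).2 ⟨fun i => ?_, fun i => ?_⟩, fun i => ?_⟩
  · rw [hcor]
    have h1 := abs_le.1 (hK.1 i)
    have h2 := abs_le.1 (hK'.1 i)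
    rw [abs_le]
    constructor
    · nlinarith
    · nlinarith
  · rw [hcor]
    simp only [Pi.add_apply, Pi.smul_apply, smul_eq_mul]
    have hss : SignType.sign (x i) = SignType.sign (x' i) := (hxs i).trans (hxs' i).symm
    rcases lt_trichotomy (x i) 0 with h | h | h
    · have h' : x' i < 0 := by rw [sign_neg h] at hss; exact sign_eq_neg_one_iff.1 hss.symm
      have := hcomb _ _ (neg_pos.2 h) (neg_pos.2 h')
      rw [cor_neg a hlam hx h, cor_neg a hlam hx' h', abs_of_neg (by linarith)]
      linear_combination (-(α * x i + β * x' i) * lam) * hαβ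
    · have h' : x' i = 0 := by rw [h, sign_zero] at hss; exact sign_eq_zero_iff.1 hss.symm
      simp [h, h']
    · have h' : 0 < x' i := by rw [sign_pos h] at hss; exact sign_eq_one_iff.1 hss.symm
      have := hcomb _ _ h h'
      rw [cor_pos a hlam hx h, cor_pos a hlam hx' h', abs_of_pos (by linarith)]
      linear_combination ((α * x i + β * x' i) * lam) * hαβ
  · rw [← hxs i]
    simp only [Pi.add_apply, Pi.smul_apply, smul_eq_mul]
    have hss : SignType.sign (x i) = SignType.sign (x' i) := (hxs i).trans (hxs' i).symm
    rcases lt_trichotomy (x i) 0 with h | h | h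
    · have h' : x' i < 0 := by rw [sign_neg h] at hss; exact sign_eq_neg_one_iff.1 hss.symm
      have := hcomb _ _ (neg_pos.2 h) (neg_pos.2 h')
      rw [sign_neg h, sign_neg (by linarith)]
    · have h' : x' i = 0 := by rw [h, sign_zero] at hss; exact sign_eq_zero_iff.1 hss.symm
      simp [h, h']
    · have h' : 0 < x' i := by rw [sign_pos h] at hss; exact sign_eq_one_iff.1 hss.symm
      have := hcomb _ _ h h'
      rw [sign_pos h, sign_pos (by linarith)]

lemma ae_local {n p : ℕ} (a : Fin p → Fin n → ℝ) {lam : ℝ} (hlam : 0 < lam)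
    (f : (Fin n → ℝ) → Fin n → ℝ)
    (hf : ∀ z, ∃ x : Fin p → ℝ, IsLassoSolPi a lam z x ∧ f z = fun j => ∑ i, x i * a i j)
    (m : (Fin n → ℝ) → ℕ)
    (hm : ∀ z, IsLeast
      {k : ℕ | ∃ x : Fin p → ℝ, IsLassoSolPi a lam z x ∧ {i | x i ≠ 0}.ncard = k} (m z)) :
    ∀ᵐ z : Fin n → ℝ, ∃ Q : Fin n → Fin n → ℝ, ∑ i, Q i i = m z ∧
      ∑ i, ∑ j, Q i j * Q j i = m z ∧
      ∀ᶠ z' in 𝓝 z, ∀ j, f z' j = f z j + ∑ i, Q i j * (z' i - z i) := by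
  have hfx : ∀ z x, IsLassoSolPi a lam z x → ∀ j, f z j = Ax a x j := by
    intro z x hx j
    obtain ⟨x1, h1, h2⟩ := hf z
    rw [h2]
    exact Ax_unique a hlam h1 hx j
  have hfr : ∀ᵐ z : Fin n → ℝ, ∀ s : Fin p → SignType, z ∉ frontier (region a lam s) := by
    rw [ae_all_iff]
    intro s
    exact measure_eq_zero_iff_ae_notMem.1 ((convex_region a hlam s).addHaar_frontier volume)
  filter_upwards [hfr] with z hz
  obtain ⟨⟨x, hx, hxm⟩, hlow⟩ := hm z
  have hmin : ∀ x', IsLassoSolPi a lam z x' → {i | x i ≠ 0}.ncard ≤ {i | x' i ≠ 0}.ncard := by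
    intro x' hx'
    rw [hxm]
    exact hlow ⟨x', hx', rfl⟩
  obtain ⟨Q, hQ1, hQ2, hQ3⟩ := exists_proj a _ (indep_of_min a hlam hx hmin)
  have hcard : (Finset.univ.filter fun i => x i ≠ 0).card = m z := by
    rw [← hxm, ← Set.ncard_coe_finset]
    congr 1
    ext i; simp
  rw [hcard] at hQ1 hQ2
  refine ⟨Q, hQ1, hQ2, ?_⟩
  set s : Fin p → SignType := fun i => SignType.sign (x i) with hs
  have hzr : z ∈ region a lam s := ⟨x, hx, fun i => rfl⟩
  have hint : z ∈ interior (region a lam s) := by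
    by_contra hcon
    exact hz s ⟨subset_closure hzr, hcon⟩
  filter_upwards [mem_interior_iff_mem_nhds.1 hint] with z' hz' j
  obtain ⟨x', hx', hxs'⟩ := hz'
  rw [hfx z' x' hx', hfx z x hx]
  have hd : x' = x + (x' - x) := by abel
  have hAd : ∀ l, Ax a (x' - x) l = Ax a x' l - Ax a x l := by
    intro l
    have := Ax_add a x (x' - x) l
    rw [← hd] at this
    linarith
  have := hQ3 (x' - x) (fun l => z' l - z l) ?_ ?_ j
  · rw [← this, hAd]; ring
  · intro i hi
    have hxi : x i = 0 := by simpa using hi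
    have h1 := hxs' i
    simp only [hs, hxi, sign_zero] at h1
    simp [hxi, sign_eq_zero_iff.1 h1]
  · intro i hi
    have hxi : x i ≠ 0 := by simpa using hi
    have hcc : cor a z' x' i = cor a z x i := by
      have h1 := hxs' i
      simp only [hs] at h1
      rcases lt_or_gt_of_ne hxi with h | h
      · rw [sign_neg h] at h1
        rw [cor_neg a hlam hx h, cor_neg a hlam hx' (sign_eq_neg_one_iff.1 h1)]
      · rw [sign_pos h] at h1
        rw [cor_pos a hlam hx h, cor_pos a hlam hx' (sign_eq_one_iff.1 h1)]
    have e : ∑ l, a i l * (z' l - z l - Ax a (x' - x) l) = cor a z' x' i - cor a z x i := by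
      simp only [cor, ← Finset.sum_sub_distrib]
      exact Finset.sum_congr rfl fun l _ => by rw [hAd]; ring
    rw [e, hcc, sub_self]

end LassoAux

/-- Theorem 2, reliability identity. Fix `λ > 0`, let `μ = A x⁰` and
`P = N(μ, σ² Id)` on `ℝⁿ`. With `f` the Lasso-fit map, `m` the minimal support size,
`SURE(y) = −nσ² + ‖f(y) − y‖₂² + 2σ² m(y)` and `SE(y) = ‖f(y) − μ‖₂²`, one has
`∫ (SURE(y) − SE(y))² dP = −2σ⁴n + 4σ² ∫ ‖f(y) − y‖₂² dP + 4σ⁴ ∫ m(y) dP`. -/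
theorem lasso_sure_reliability_identity {n p : ℕ} (a : Fin p → Fin n → ℝ)
    (lam : ℝ) (hlam : 0 < lam) (x0 : Fin p → ℝ) (σ : ℝ) (hσ : 0 < σ)
    (μ : Fin n → ℝ) (hμ : μ = fun j => ∑ i, x0 i * a i j)
    (P : Measure (Fin n → ℝ))
    (hP : P = Measure.pi fun j => gaussianReal (μ j) (Real.toNNReal (σ ^ 2)))
    (f : (Fin n → ℝ) → Fin n → ℝ) (hfmeas : Measurable f)
    (hf : ∀ z, ∃ x : Fin p → ℝ, IsLassoSolPi a lam z x ∧ f z = fun j => ∑ i, x i * a i j)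
    (m : (Fin n → ℝ) → ℕ) (hmmeas : Measurable m)
    (hm : ∀ z, IsLeast
      {k : ℕ | ∃ x : Fin p → ℝ, IsLassoSolPi a lam z x ∧ {i | x i ≠ 0}.ncard = k} (m z)) :
    ∫ y, ((-(n : ℝ) * σ ^ 2 + ∑ j, (f y j - y j) ^ 2 + 2 * σ ^ 2 * (m y : ℝ))
        - ∑ j, (f y j - μ j) ^ 2) ^ 2 ∂P
      = -2 * σ ^ 4 * n + 4 * σ ^ 2 * (∫ y, ∑ j, (f y j - y j) ^ 2 ∂P)
        + 4 * σ ^ 4 * (∫ y, (m y : ℝ) ∂P) := by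
  classical
  have hP' : P = LassoAux.G μ σ := hP
  subst hP'
  clear hP
  have hv : Real.toNNReal (σ ^ 2) ≠ 0 := by simp; positivity
  have hac : LassoAux.G μ σ ≪ (volume : Measure (Fin n → ℝ)) := by
    rw [LassoAux.G, LassoAux.pi_gaussian_eq μ _ hv]
    exact withDensity_absolutelyContinuous _ _
  have hloc := hac.ae_le (LassoAux.ae_local a hlam f hf m hm)
  let good : (Fin n → ℝ) → (Fin n → Fin n → ℝ) → Prop := fun z Q =>
    ∑ i, Q i i = m z ∧ ∑ i, ∑ j, Q i j * Q j i = m z ∧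
      ∀ᶠ z' in nhds z, ∀ j, f z' j = f z j + ∑ i, Q i j * (z' i - z i)
  let Q : (Fin n → ℝ) → Fin n → Fin n → ℝ := fun z =>
    if h : ∃ Q, good z Q then h.choose else 0
  have hQ : ∀ᵐ z ∂(LassoAux.G μ σ), good z (Q z) := by
    change ∀ᵐ z ∂(LassoAux.G μ σ), _ at hloc
    filter_upwards [hloc] with z hz
    have hz' : ∃ Q, good z Q := hz
    simp only [Q, dif_pos hz']
    exact hz'.choose_spec
  have hLip : ∀ y z j, |f y j - f z j| ≤ LassoAux.N (y - z) := by
    intro y z j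
    obtain ⟨x, hx, h1⟩ := hf y
    obtain ⟨x', hx', h2⟩ := hf z
    rw [h1, h2]
    exact LassoAux.lip_sol a hlam hx hx' j
  have hPAf : LassoAux.PA (LassoAux.G μ σ) f Q := by
    refine LassoAux.PA.of hfmeas 1 (fun y z j => by rw [one_mul]; exact hLip y z j) ?_
    filter_upwards [hQ] with z hz using hz.2.2
  -- the vector field of the second order formula
  let h : (Fin n → ℝ) → Fin n → ℝ := fun y j => 2 * f y j - y j - μ j
  let J : (Fin n → ℝ) → Fin n → Fin n → ℝ := fun y i j => 2 * Q y i j - if i = j then 1 else 0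
  have hPAh : LassoAux.PA (LassoAux.G μ σ) h J := by
    refine LassoAux.PA.of ?_ 3 (fun y z j => ?_) ?_
    · refine measurable_pi_lambda _ fun j => ?_
      have := (measurable_pi_apply j).comp hfmeas
      exact ((this.const_mul 2).sub (measurable_pi_apply j)).sub_const _
    · have h1 := hLip y z j
      have h2 := LassoAux.abs_coord_le (y - z) j
      simp only [Pi.sub_apply] at h2
      have e : h y j - h z j = 2 * (f y j - f z j) - (y j - z j) := by simp only [h]; ring
      rw [e, abs_le]
      rw [abs_le] at h1 h2
      constructor <;> linarith
    · filter_upwards [hQ] with z hz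
      filter_upwards [hz.2.2] with z' hz' j
      simp only [h, J, hz' j, sub_mul, Finset.sum_sub_distrib, mul_assoc, ← Finset.mul_sum]
      simp
      ring
  have hmain := hPAh.main hσ
  -- traces
  have htr : ∀ᵐ y ∂(LassoAux.G μ σ), ∑ i, J y i i = 2 * (m y : ℝ) - n := by
    filter_upwards [hQ] with y hy
    simp only [J, Finset.sum_sub_distrib, ← Finset.mul_sum, hy.1]
    simp
  have htr2 : ∀ᵐ y ∂(LassoAux.G μ σ), ∑ i, ∑ j, J y i j * J y j i = n := by
    filter_upwards [hQ] with y hy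
    have e : ∀ i j, J y i j * J y j i = 4 * (Q y i j * Q y j i)
        + (if i = j then 1 - 4 * Q y i i else 0) := by
      intro i j
      simp only [J]
      by_cases hij : i = j
      · subst hij; simp; ring
      · have hji : j ≠ i := fun h => hij h.symm
        simp [hij, hji]; ring
    simp only [e, Finset.sum_add_distrib, ← Finset.mul_sum, hy.2.1]
    simp only [Finset.sum_ite_eq, Finset.mem_univ, if_true, Finset.sum_sub_distrib,
      ← Finset.mul_sum, hy.1]
    simp
  -- integrability
  have gf := fun i => (hPAf.dif i i).good
  have gw := fun i => (LassoAux.PA.wgood (μ := μ) (σ := σ) i i)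
  have gd : ∀ i, LassoAux.Dif (LassoAux.G μ σ) i (fun y => f y i - y i) (fun y => Q y i i - 1) := by
    intro i
    convert (hPAf.dif i i).add ((LassoAux.Dif.const (-1)).mul (LassoAux.Dif.coord i)) using 2
    · ring
    · simp; ring
  have hm_int : Integrable (fun y => (m y : ℝ)) (LassoAux.G μ σ) := by
    have h1 := (LassoAux.Good.sum Finset.univ fun i => (hPAf.dif i i).dgood).integrable
    refine h1.congr ?_
    filter_upwards [hQ] with y hy using hy.1
  have i1 := fun i => ((gd i).good.mul (gd i).good).integrable
  have i2 := fun i => ((gd i).good.mul (gw i).good).integrable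
  have i3 := fun i => ((gw i).good.mul (gw i).good).integrable
  have s2 := fun i => (gd i).stein hσ
  have s3 := fun i => (gw i).stein hσ
  have hh : ∀ i, ∫ y, h y i ^ 2 ∂(LassoAux.G μ σ) =
      4 * ∫ y, (f y i - y i) ^ 2 ∂(LassoAux.G μ σ)
      + 4 * σ ^ 2 * ∫ y, (Q y i i - 1) ∂(LassoAux.G μ σ) + σ ^ 2 := by
    intro i
    have e : ∀ y, h y i ^ 2 = (4 * ((f y i - y i) * (f y i - y i))
        + 4 * ((f y i - y i) * (y i - μ i))) + (y i - μ i) * (y i - μ i) := by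
      intro y; simp only [h]; ring
    have i12 : Integrable (fun y => 4 * ((f y i - y i) * (f y i - y i))
        + 4 * ((f y i - y i) * (y i - μ i))) (LassoAux.G μ σ) :=
      ((i1 i).const_mul 4).add ((i2 i).const_mul 4)
    have hprob : IsProbabilityMeasure (LassoAux.G μ σ) := by unfold LassoAux.G; infer_instance
    simp_rw [e]
    rw [integral_add i12 (i3 i), integral_add ((i1 i).const_mul 4) ((i2 i).const_mul 4),
      integral_const_mul, integral_const_mul, s2, s3]
    simp only [← pow_two]
    simp
    ring
  have hsumQ : ∑ i, ∫ y, (Q y i i - 1) ∂(LassoAux.G μ σ) = ∫ y, (m y : ℝ) ∂(LassoAux.G μ σ) - n := by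
    have hprob : IsProbabilityMeasure (LassoAux.G μ σ) := by unfold LassoAux.G; infer_instance
    rw [← integral_finsetSum _ fun i _ => (gd i).dgood.integrable]
    have : ∫ y, ∑ i, (Q y i i - 1) ∂(LassoAux.G μ σ) = ∫ y, ((m y : ℝ) - n) ∂(LassoAux.G μ σ) := by
      refine integral_congr_ae ?_
      filter_upwards [hQ] with y hy
      rw [Finset.sum_sub_distrib, hy.1]
      simp
    rw [this, integral_sub hm_int (integrable_const _)]
    simp
  have hJJ : ∑ i, ∑ j, ∫ y, J y i j * J y j i ∂(LassoAux.G μ σ) = n := by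
    have hprob : IsProbabilityMeasure (LassoAux.G μ σ) := by unfold LassoAux.G; infer_instance
    have ij : ∀ i j, Integrable (fun y => J y i j * J y j i) (LassoAux.G μ σ) := fun i j =>
      ((hPAh.dif i j).dgood.mul (hPAh.dif j i).dgood).integrable
    have : ∀ i, ∑ j, ∫ y, J y i j * J y j i ∂(LassoAux.G μ σ) =
        ∫ y, ∑ j, J y i j * J y j i ∂(LassoAux.G μ σ) := fun i =>
      (integral_finsetSum _ fun j _ => ij i j).symm
    simp_rw [this]
    rw [← integral_finsetSum _ fun i _ => integrable_finsetSum _ fun j _ => ij i j,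
      integral_congr_ae htr2]
    simp
  have hr : ∫ y, ∑ j, (f y j - y j) ^ 2 ∂(LassoAux.G μ σ) =
      ∑ j, ∫ y, (f y j - y j) ^ 2 ∂(LassoAux.G μ σ) :=
    integral_finsetSum _ fun j _ => by simpa only [pow_two] using i1 j
  have hlhs : ∫ y, ((-(n : ℝ) * σ ^ 2 + ∑ j, (f y j - y j) ^ 2 + 2 * σ ^ 2 * (m y : ℝ))
        - ∑ j, (f y j - μ j) ^ 2) ^ 2 ∂(LassoAux.G μ σ) =
      ∫ y, (∑ i, h y i * (y i - μ i) - σ ^ 2 * ∑ i, J y i i) ^ 2 ∂(LassoAux.G μ σ) := by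
    refine integral_congr_ae ?_
    filter_upwards [htr] with y hy
    have e : ∑ i, h y i * (y i - μ i) = ∑ j, (f y j - μ j) ^ 2 - ∑ j, (f y j - y j) ^ 2 := by
      rw [← Finset.sum_sub_distrib]
      exact Finset.sum_congr rfl fun j _ => by simp only [h]; ring
    rw [hy, e]
    ring
  rw [hlhs, hmain, hJJ, hr]
  simp only [hh, Finset.sum_add_distrib, ← Finset.mul_sum, hsumQ]
  simp
  ring
end
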